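/- Let q = p^e be a power of a prime with q ≡ 1 (mod 6) and set t = (q-1)/6, ω₆ = ω^t, ω₃ = ω^{2t}, ω₂ = ω^{3t}. For every λ ∈ 𝔽_q with λ ≠ 0 and λ⁶ ≠ 1, the number of 𝔽_q-rational points on the Dwork hypersurface X_λ⁶ satisfies: #X_λ⁶(𝔽_q) = (q⁵-1)/(q-1) + 360·q²·ω₂(1-λ⁶) + q⁴·₅F₄(ω₆,ω₃,ω₂,ω̄₃,ω̄₆; ε,ε,ε,ε | 1/λ⁶)_q + 30·q³·ω₆(-1)·₃F₂(ω₃,ω₂,ω̄₃; ε,ε | 1/λ⁶)_q + 30·q³·₃F₂(ω₆,ω₂,ω̄₆; ε,ε | 1/λ⁶)_q − 15·q³·ω₆(-1)·J(ω₂,ω̄₃,ω̄₆)·₄F₃(ω₆,ω̄₆,ω̄₃,ω₃; ε,ε,ω₂ | 1/λ⁶)_q − 20·q³·ω₆(-1)·J(ω₆,ω₃,ω₂)·₄F₃(ω₆,ω₂,ω̄₃,ω̄₆; ε,ω₃,ω₃ | 1/λ⁶)_q + 60·q²·ω₆(-1)·J(ω₆,ω₆,ω̄₃)·J(ω₂,ω̄₃,ω̄₆)·₃F₂(ω₆,ω̄₃,ω₂;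 ε,ω̄₆ | 1/λ⁶)_q + 60·q²·J(ω₃,ω₃,ω₃)·J(ω₂,ω̄₃,ω̄₆)·₃F₂(ω₃,ω̄₆,ω₂; ε,ω₆ | 1/λ⁶)_q + 90·q³·₃F₂(ω₂,ω̄₃,ω̄₆; ω₆,ω₃ | 1/λ⁶)_q − 30·q²·J(ω₆,ω₆)·J(ω₆,ω₃,ω₂)·₃F₂(ω₆,ω₂,ω̄₆; ω₃,ω̄₃ | 1/λ⁶)_q − 120·q²·J(ω₆,ω₃,ω₂)·₂F₁(ω₆,ω₃; ε | 1/λ⁶)_q − 120·q²·J(ω₂,ω̄₃,ω̄₆)·₂F₁(ω̄₃,ω̄₆; ε | 1/λ⁶)_q − 180·q²·J(ω₆,ω₃,ω₂)·₂F₁(ω₃,ω̄₃; ω₂ | 1/λ⁶)_q − 180·q²·J(ω₆,ω₃,ω₂)·₂F₁(ω₃,ω̄₆; ω̄₃ | 1/λ⁶)_q. -/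

import Mathlib

open scoped Classical

noncomputable section

/-- The Gauss sum `g(χ) = ∑ₓ χ(x) exp(2π√-1 · tr(x)/p)` of a multiplicative character `χ`
of a finite field `F` of characteristic `p`, where `tr : F → 𝔽_p` is the trace map. -/
def gaussChar (p : ℕ) (F : Type) [Field F] [Fintype F] [Algebra (ZMod p) F]
    (χ : MulChar F ℂ) : ℂ :=
  ∑ x : F, χ x *
    Complex.exp (2 * Real.pi * Complex.I * ((Algebra.trace (ZMod p) F x).val : ℂ) / (p : ℂ))

/-- The Jacobi sum `J(χ₁, …, χₙ) = ∑_{x₁ + ⋯ + xₙ = 1} χ₁(x₁) ⋯ χₙ(xₙ)`. -/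
def jacobiS (F : Type) [Field F] [Fintype F] {n : ℕ} (χ : Fin n → MulChar F ℂ) : ℂ :=
  ∑ v ∈ Finset.univ.filter (fun v : Fin n → F => ∑ i, v i = 1), ∏ i, χ i (v i)

/-- The normalized Jacobi sum `binom(A; B) = (B(-1)/q) · J(A, B̄)`. -/
def gBinom (F : Type) [Field F] [Fintype F] (A B : MulChar F ℂ) : ℂ :=
  B (-1) / (Fintype.card F : ℂ) * jacobiS F ![A, B⁻¹]

/-- Greene's finite-field hypergeometric function `ₙ₊₁Fₙ` (case `n ≥ 2`), where the sum over all
multiplicative characters is written as a sum over the powers `ω^j`, `0 ≤ j ≤ q - 2`, of a fixed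
generator `ω` of the character group. -/
def greeneF (F : Type) [Field F] [Fintype F] (ω : MulChar F ℂ) {n : ℕ}
    (A : Fin (n + 1) → MulChar F ℂ) (B : Fin n → MulChar F ℂ) (x : F) : ℂ :=
  (Fintype.card F : ℂ) / ((Fintype.card F : ℂ) - 1) *
    ∑ j ∈ Finset.range (Fintype.card F - 1),
      gBinom F (A 0 * ω ^ j) (ω ^ j) *
        (∏ i : Fin n, gBinom F (A i.succ * ω ^ j) (B i * ω ^ j)) * (ω ^ j) x

/-- Greene's finite-field hypergeometric function `₂F₁` (case `n = 1`):
`₂F₁(A₀, A₁; B₁ | x) = ε(x) · (A₁B₁(-1)/q) · ∑_y A₁(y) (A̅₁B₁)(1-y) A̅₀(1-xy)`. -/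
def greene2F1 (F : Type) [Field F] [Fintype F] (A₀ A₁ B₁ : MulChar F ℂ) (x : F) : ℂ :=
  (1 : MulChar F ℂ) x * ((A₁ * B₁) (-1) / (Fintype.card F : ℂ)) *
    ∑ y : F, A₁ y * (A₁⁻¹ * B₁) (1 - y) * A₀⁻¹ (1 - x * y)

/-- The number of `F`-rational points of the Dwork hypersurface
`x₁^d + ⋯ + x_d^d = dλ x₁ ⋯ x_d` in projective space. -/
def dworkCount (F : Type) [Field F] [Fintype F] (d : ℕ) (lam : F) : ℕ :=
  Nat.card {P : Projectivization F (Fin d → F) //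
    ∑ i, P.rep i ^ d = (d : F) * lam * ∏ i, P.rep i}

/-- The number of `F`-rational points of the diagonal hypersurface
`x₁^d + ⋯ + xₙ^d = dλ x₁^{h₁} ⋯ xₙ^{hₙ}` in projective space. -/
def diagCount (F : Type) [Field F] [Fintype F] (d n : ℕ) (h : Fin n → ℕ) (lam : F) : ℕ :=
  Nat.card {P : Projectivization F (Fin n → F) //
    ∑ i, P.rep i ^ d = (d : F) * lam * ∏ i, P.rep i ^ h i}

/-- The quantity `N_q(0, w)` from Koblitz's formula, with `t = (q - 1)/d`. -/
def NqW (p : ℕ) (F : Type) [Field F] [Fintype F] [Algebra (ZMod p) F]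
    (ω : MulChar F ℂ) (d : ℕ) {n : ℕ} (w : Fin n → ZMod d) : ℂ :=
  if ∀ i, w i = 0 then ((Fintype.card F : ℂ) ^ (n - 1) - 1) / ((Fintype.card F : ℂ) - 1)
  else if ∀ i, w i ≠ 0 then
    (1 / (Fintype.card F : ℂ)) *
      ∏ i, gaussChar p F (ω ^ ((w i).val * ((Fintype.card F - 1) / d)))
  else 0

/-- The quantity `S_{[w]} = (q-1)⁻¹ ∑_{j=0}^{q-2} (∏ᵢ g(ω^{wᵢt + hᵢj}) / g(ω^{dj})) ω^{dj}(dλ)`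
from Koblitz's formula, with `t = (q - 1)/d`. -/
def SW (p : ℕ) (F : Type) [Field F] [Fintype F] [Algebra (ZMod p) F]
    (ω : MulChar F ℂ) (d : ℕ) {n : ℕ} (h : Fin n → ℕ) (w : Fin n → ZMod d) (lam : F) : ℂ :=
  ((Fintype.card F : ℂ) - 1)⁻¹ *
    ∑ j ∈ Finset.range (Fintype.card F - 1),
      (∏ i, gaussChar p F (ω ^ ((w i).val * ((Fintype.card F - 1) / d) + h i * j))) /
          gaussChar p F (ω ^ (d * j)) * (ω ^ (d * j)) ((d : F) * lam)

end


noncomputable instance mcFintype (F : Type) [Field F] [Fintype F] : Fintype (MulChar F ℂ) :=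
  Fintype.ofFinite _

section basics

variable {F : Type} [Field F] [Fintype F]

lemma card_mulChar : Fintype.card (MulChar F ℂ) = Fintype.card F - 1 := by
  have h := MulChar.card_eq_card_units_of_hasEnoughRootsOfUnity F ℂ
  rw [Nat.card_eq_fintype_card, Nat.card_eq_fintype_card, Fintype.card_units] at h
  exact h

lemma card_cast_sub_one : ((Fintype.card F - 1 : ℕ) : ℂ) = (Fintype.card F : ℂ) - 1 := by
  rw [Nat.cast_sub Fintype.card_pos]; simp

lemma card_ne_zero' : (Fintype.card F : ℂ) ≠ 0 := by
  exact_mod_cast Fintype.card_ne_zero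

lemma card_sub_one_ne_zero : (Fintype.card F : ℂ) - 1 ≠ 0 := by
  have h : 1 < Fintype.card F := Fintype.one_lt_card
  have : (Fintype.card F : ℂ) ≠ 1 := by exact_mod_cast h.ne'
  exact sub_ne_zero.mpr this

lemma sum_char (a : F) (ha : a ≠ 0) :
    ∑ χ : MulChar F ℂ, χ a = if a = 1 then (Fintype.card F : ℂ) - 1 else 0 := by
  split_ifs with h
  · subst h
    simp [card_mulChar, card_cast_sub_one]
  · obtain ⟨χ₀, h₀⟩ := MulChar.exists_apply_ne_one_of_hasEnoughRootsOfUnity F ℂ h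
    have : χ₀ a * ∑ χ : MulChar F ℂ, χ a = ∑ χ : MulChar F ℂ, χ a := by
      rw [Finset.mul_sum]
      refine Fintype.sum_equiv (Equiv.mulLeft χ₀) _ _ ?_
      intro χ; simp [MulChar.mul_apply]
    have h2 : (χ₀ a - 1) * ∑ χ : MulChar F ℂ, χ a = 0 := by rw [sub_mul, this]; ring
    exact (mul_eq_zero.mp h2).resolve_left (sub_ne_zero.mpr h₀)

/-- Orthogonality, two point form. -/
lemma sum_char_inv_mul (a b : F) (ha : a ≠ 0) (hb : b ≠ 0) :
    ∑ χ : MulChar F ℂ, χ⁻¹ a * χ b = if b = a then (Fintype.card F : ℂ) - 1 else 0 := by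
  have h := sum_char (a⁻¹ * b) (mul_ne_zero (inv_ne_zero ha) hb)
  rw [show (a⁻¹ * b = 1) = (b = a) by
    apply propext; constructor
    · intro h; field_simp at h; exact h
    · rintro rfl; field_simp] at h
  rw [← h]
  refine Finset.sum_congr rfl fun χ _ => ?_
  rw [map_mul, MulChar.inv_apply']

lemma char_sum (χ : MulChar F ℂ) :
    ∑ x : F, χ x = if χ = 1 then (Fintype.card F : ℂ) - 1 else 0 := by
  split_ifs with h
  · subst h
    rw [MulChar.sum_one_eq_card_units, Fintype.card_units, card_cast_sub_one]
  · exact MulChar.sum_eq_zero_of_ne_one h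

variable (ω : MulChar F ℂ) (hω : ∀ χ : MulChar F ℂ, ∃ j : ℕ, χ = ω ^ j)

include hω

lemma orderOf_gen : orderOf ω = Fintype.card F - 1 := by
  rw [← card_mulChar, ← Nat.card_eq_fintype_card]
  refine orderOf_eq_card_of_forall_mem_zpowers ?_
  intro χ
  obtain ⟨j, rfl⟩ := hω χ
  exact Subgroup.npow_mem_zpowers ω j

lemma sum_gen (h : MulChar F ℂ → ℂ) :
    ∑ j ∈ Finset.range (Fintype.card F - 1), h (ω ^ j) = ∑ χ : MulChar F ℂ, h χ := by
  refine Finset.sum_bij (fun j _ => ω ^ j) (fun _ _ => Finset.mem_univ _) ?_ ?_ (fun _ _ => rfl)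
  · intro a ha b hb hab
    rw [← orderOf_gen ω hω, Finset.mem_range] at ha hb
    exact pow_injOn_Iio_orderOf ha hb hab
  · intro χ _
    obtain ⟨j, rfl⟩ := hω χ
    refine ⟨j % orderOf ω, ?_, pow_mod_orderOf ω j⟩
    rw [← orderOf_gen ω hω, Finset.mem_range]
    apply Nat.mod_lt
    rw [orderOf_gen ω hω]
    have : 1 < Fintype.card F := Fintype.one_lt_card
    omega

lemma pow_eq_one_iff_gen (d m : ℕ) (hd : 0 < d) (hdm : d * m = Fintype.card F - 1)
    (χ : MulChar F ℂ) : χ ^ d = 1 ↔ ∃ a ∈ Finset.range d, χ = (ω ^ m) ^ a := by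
  have hord := orderOf_gen ω hω
  have hq : 1 < Fintype.card F := Fintype.one_lt_card
  constructor
  · intro h
    obtain ⟨j, rfl⟩ := hω χ
    rw [← pow_mul] at h
    have h1 := orderOf_dvd_of_pow_eq_one h
    rw [hord, ← hdm, mul_comm j d] at h1
    obtain ⟨k, rfl⟩ := Nat.dvd_of_mul_dvd_mul_left hd h1
    refine ⟨k % d, Finset.mem_range.mpr (Nat.mod_lt _ hd), ?_⟩
    rw [pow_mul]
    conv_lhs => rw [← Nat.mod_add_div k d]
    rw [pow_add, pow_mul (ω ^ m) d, ← pow_mul ω m d, mul_comm m d, hdm, ← hord, pow_orderOf_eq_one,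
      one_pow, mul_one]
  · rintro ⟨a, -, rfl⟩
    rw [← pow_mul, ← pow_mul, show m * (a * d) = (d * m) * a by ring, hdm, ← hord, pow_mul,
      pow_orderOf_eq_one, one_pow]

lemma orderOf_gen_pow (d m : ℕ) (hdm : d * m = Fintype.card F - 1) :
    orderOf (ω ^ m) = d := by
  have hord := orderOf_gen ω hω
  have hq : 1 < Fintype.card F := Fintype.one_lt_card
  have hm : m ≠ 0 := by rintro rfl; omega
  rw [orderOf_pow_of_dvd hm (by rw [hord, ← hdm]; exact Dvd.intro_left d rfl), hord, ← hdm,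
    Nat.mul_div_cancel _ (Nat.pos_of_ne_zero hm)]

lemma count_pow (d m : ℕ) (hd : 0 < d) (hdm : d * m = Fintype.card F - 1) (u : F) (hu : u ≠ 0) :
    ((Finset.univ.filter (fun x : F => x ^ d = u)).card : ℂ) =
      ∑ a ∈ Finset.range d, ((ω ^ m) ^ a) u := by
  have hq1 : (Fintype.card F : ℂ) - 1 ≠ 0 := card_sub_one_ne_zero
  have key : ((Finset.univ.filter (fun x : F => x ^ d = u)).card : ℂ) * ((Fintype.card F : ℂ) - 1) =
      ∑ χ : MulChar F ℂ, χ u * ∑ x : F, (χ⁻¹ ^ d) x := by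
    simp_rw [Finset.mul_sum]
    rw [Finset.sum_comm, Finset.card_filter]
    push_cast
    rw [Finset.sum_mul]
    refine Finset.sum_congr rfl fun x _ => ?_
    by_cases hx : x = 0
    · subst hx
      rw [zero_pow hd.ne']
      rw [if_neg hu.symm]
      symm
      rw [zero_mul]
      refine Finset.sum_eq_zero fun χ _ => ?_
      rw [MulChar.map_zero, mul_zero]
    · have h := sum_char_inv_mul (x ^ d) u (pow_ne_zero d hx) hu
      have h2 : ∑ χ : MulChar F ℂ, χ u * (χ⁻¹ ^ d) x = ∑ χ : MulChar F ℂ, χ⁻¹ (x ^ d) * χ u := by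
        refine Finset.sum_congr rfl fun χ _ => ?_
        rw [MulChar.pow_apply' _ hd.ne', map_pow, mul_comm]
      rw [h2, h]
      simp [eq_comm]
  rw [← mul_left_inj' hq1, key]
  simp_rw [char_sum, inv_pow, inv_eq_one]
  rw [← Finset.sum_filter_add_sum_filter_not _ (fun χ : MulChar F ℂ => χ ^ d = 1)]
  rw [Finset.sum_eq_zero (s := Finset.univ.filter (fun χ : MulChar F ℂ => ¬ χ ^ d = 1)), add_zero,
    Finset.sum_mul]
  · symm
    refine Finset.sum_bij (fun a _ => (ω ^ m) ^ a) ?_ ?_ ?_ ?_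
    · intro a ha
      simp only [Finset.mem_filter, Finset.mem_univ, true_and]
      exact (pow_eq_one_iff_gen ω hω d m hd hdm _).mpr ⟨a, ha, rfl⟩
    · intro a ha b hb hab
      rw [Finset.mem_range, ← orderOf_gen_pow ω hω d m hdm] at ha hb
      exact pow_injOn_Iio_orderOf ha hb hab
    · intro χ hχ
      simp only [Finset.mem_filter, Finset.mem_univ, true_and] at hχ
      obtain ⟨a, ha, rfl⟩ := (pow_eq_one_iff_gen ω hω d m hd hdm _).mp hχ
      exact ⟨a, ha, rfl⟩
    · intro a ha
      rw [if_pos]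
      exact (pow_eq_one_iff_gen ω hω d m hd hdm _).mpr ⟨a, ha, rfl⟩
  · intro χ hχ
    simp only [Finset.mem_filter, Finset.mem_univ, true_and] at hχ
    rw [if_neg hχ, mul_zero]

end basics

section gauss

variable {F : Type} [Field F] [Fintype F]

lemma exists_primitive (F : Type) [Field F] [Fintype F] : ∃ ψ : AddChar F ℂ, ψ ≠ 1 := by
  obtain ⟨ψ, h⟩ := (AddChar.exists_apply_ne_zero (α := F) (a := 1)).mpr one_ne_zero
  exact ⟨ψ, by rintro rfl; simp at h⟩

variable {ψ : AddChar F ℂ} (hψ : ψ ≠ 1)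
include hψ

lemma gs_mul_inv {χ : MulChar F ℂ} (hχ : χ ≠ 1) :
    gaussSum χ ψ * gaussSum χ⁻¹ ψ = χ (-1) * Fintype.card F := by
  have h := gaussSum_mul_gaussSum_eq_card hχ (AddChar.IsPrimitive.of_ne_one hψ)
  have h2 := mul_gaussSum_inv_eq_gaussSum χ⁻¹ ψ
  rw [← h2, ← h, MulChar.inv_apply']
  rw [show (-1 : F)⁻¹ = -1 by norm_num]; ring

lemma gs_ne_zero (χ : MulChar F ℂ) : gaussSum χ ψ ≠ 0 := by
  by_cases h : χ = 1
  · subst h; rw [gaussSum_one_left hψ]; norm_num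
  · exact gaussSum_ne_zero_of_nontrivial card_ne_zero' h (AddChar.IsPrimitive.of_ne_one hψ)

omit hψ in
lemma gs_shift (χ : MulChar F ℂ) (ψ : AddChar F ℂ) (c : F) (hc : c ≠ 0) :
    ∑ x : F, χ x * ψ (c * x) = χ⁻¹ c * gaussSum χ ψ :=
  gaussSum_mulShift_eq χ ψ (Units.mk0 c hc)

lemma sum_add_shift (c : F) :
    ∑ x : F, ψ (c * x) = if c = 0 then (Fintype.card F : ℂ) else 0 := by
  have h := AddChar.sum_mulShift c (AddChar.IsPrimitive.of_ne_one hψ)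
  simp_rw [mul_comm c]
  rw [h]
  push_cast
  rfl

lemma jac_eq {A B : MulChar F ℂ} (h : A * B ≠ 1) :
    jacobiSum A B = gaussSum A ψ * gaussSum B ψ / gaussSum (A * B) ψ :=
  jacobiSum_eq_gaussSum_mul_gaussSum_div_gaussSum card_ne_zero' h (AddChar.IsPrimitive.of_ne_one hψ)

end gauss

section dupl

variable {F : Type} [Field F] [Fintype F]
variable (ω : MulChar F ℂ) (hω : ∀ χ : MulChar F ℂ, ∃ j : ℕ, χ = ω ^ j)

include hω

lemma count_sq (m : ℕ) (hm : 2 * m = Fintype.card F - 1) (z : F) :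
    ((Finset.univ.filter (fun x : F => x ^ 2 = z)).card : ℂ) = 1 + (ω ^ m) z := by
  by_cases hz : z = 0
  · subst hz
    have : Finset.univ.filter (fun x : F => x ^ 2 = 0) = {0} := by ext; simp
    rw [this]
    simp [MulChar.map_zero]
  · rw [count_pow ω hω 2 m (by norm_num) hm z hz]
    simp [Finset.sum_range_succ, MulChar.one_apply, hz]

lemma jac_dup (m : ℕ) (hm : 2 * m = Fintype.card F - 1) (h2 : (2 : F) ≠ 0)
    (χ : MulChar F ℂ) (hχ : χ ≠ 1) :
    χ 4 * jacobiSum χ χ = jacobiSum χ (ω ^ m) := by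
  have e1 : χ 4 * jacobiSum χ χ = ∑ y : F, χ (1 - y ^ 2) := by
    rw [jacobiSum, Finset.mul_sum]
    refine Fintype.sum_bijective (fun x : F => 2 * x - 1) ?_ _ _ ?_
    · constructor
      · intro a b hab
        have : (2 : F) * a = 2 * b := by simpa using hab
        exact mul_left_cancel₀ h2 this
      · intro y
        exact ⟨(y + 1) / 2, by field_simp; ring⟩
    · intro x
      rw [← map_mul, ← map_mul]
      congr 1; ring
  have e2 : ∑ y : F, χ (1 - y ^ 2) = ∑ z : F, (1 + (ω ^ m) z) * χ (1 - z) := by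
    simp_rw [← count_sq ω hω m hm, Finset.card_filter]
    push_cast
    simp_rw [Finset.sum_mul]
    rw [Finset.sum_comm]
    refine Finset.sum_congr rfl fun y _ => ?_
    simp
  rw [e1, e2]
  simp_rw [add_mul, one_mul]
  rw [Finset.sum_add_distrib, jacobiSum_comm]
  have : ∑ z : F, χ (1 - z) = 0 := by
    rw [← MulChar.sum_eq_zero_of_ne_one hχ]
    exact Fintype.sum_equiv (Equiv.subLeft 1) _ _ (fun z => rfl)
  rw [this, zero_add]
  rfl

lemma gauss_dup (m : ℕ) (hm : 2 * m = Fintype.card F - 1) (h2 : (2 : F) ≠ 0)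
    {ψ : AddChar F ℂ} (hψ : ψ ≠ 1) (χ : MulChar F ℂ) :
    gaussSum χ ψ * gaussSum (χ * ω ^ m) ψ * χ 4 = gaussSum (χ ^ 2) ψ * gaussSum (ω ^ m) ψ := by
  have hφ2 : (ω ^ m) * (ω ^ m) = 1 := by
    rw [← pow_add, ← two_mul, hm, ← orderOf_gen ω hω, pow_orderOf_eq_one]
  by_cases h : χ ^ 2 = 1
  · obtain ⟨a, ha, rfl⟩ := (pow_eq_one_iff_gen ω hω 2 m (by norm_num) hm χ).mp h
    have h4 : (4 : F) = 2 ^ 2 := by norm_num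
    have ha' : a = 0 ∨ a = 1 := by
      rw [Finset.mem_range] at ha; omega
    rw [h]
    have h4' : ((ω ^ m) ^ a) 4 = 1 := by
      rw [h4, map_pow, ← MulChar.pow_apply' _ (by norm_num), h]
      exact MulChar.one_apply (isUnit_iff_ne_zero.mpr h2)
    rw [h4']
    rcases ha' with rfl | rfl
    · simp
    · simp [hφ2, mul_comm]
  · have hχ : χ ≠ 1 := by rintro rfl; simp at h
    have hχφ : χ * ω ^ m ≠ 1 := by
      intro h'
      apply h
      have : χ = ω ^ m := by
        calc χ = χ * (ω ^ m * ω ^ m) := by rw [hφ2, mul_one]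
          _ = (χ * ω ^ m) * ω ^ m := by rw [mul_assoc]
          _ = ω ^ m := by rw [h', one_mul]
      rw [this, pow_two, hφ2]
    have hj := jac_dup ω hω m hm h2 χ hχ
    rw [jac_eq hψ hχφ, jac_eq hψ (by rwa [← pow_two])] at hj
    rw [← pow_two χ] at hj
    have n1 := gs_ne_zero hψ χ
    have n2 := gs_ne_zero hψ (χ ^ 2)
    have n3 := gs_ne_zero hψ (χ * ω ^ m)
    field_simp at hj
    rw [← hj]; ring

end dupl

section tripl

variable {F : Type} [Field F] [Fintype F]

/-- The set of `c ≠ 0` with `c + k³/c = d`. -/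
noncomputable def cset (k d : F) : Finset F :=
  Finset.univ.filter (fun c : F => c ≠ 0 ∧ c + k ^ 3 / c = d)

/-- The set of `w` with `w³ - 3kw = d`. -/
noncomputable def wset (k d : F) : Finset F :=
  Finset.univ.filter (fun w : F => w ^ 3 - 3 * k * w = d)

lemma mem_cset {k d c : F} : c ∈ cset k d ↔ c ≠ 0 ∧ c + k ^ 3 / c = d := by simp [cset]
lemma mem_wset {k d w : F} : w ∈ wset k d ↔ w ^ 3 - 3 * k * w = d := by simp [wset]

/-- If `w² - 4k` is a square then a root `w` gives an element of `cset` which is a cube. -/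
lemma cset_of_square {k d w r : F} (h2 : (2 : F) ≠ 0) (hk : k ≠ 0)
    (hw : w ^ 3 - 3 * k * w = d) (hr : w ^ 2 - 4 * k = r ^ 2) :
    ∃ t : F, t ≠ 0 ∧ t ^ 3 + k ^ 3 / t ^ 3 = d := by
  have h4 : (4 : F) ≠ 0 := by
    rw [show (4 : F) = 2 * 2 by norm_num]; exact mul_ne_zero h2 h2
  have hp : (w + r) / 2 * ((w - r) / 2) = k := by
    field_simp
    linear_combination hr
  have ht : (w + r) / 2 ≠ 0 := by
    intro h; rw [h, zero_mul] at hp; exact hk hp.symm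
  refine ⟨(w + r) / 2, ht, ?_⟩
  have hkt : k / ((w + r) / 2) = (w - r) / 2 := by
    rw [div_eq_iff ht, ← hp]; ring
  rw [← div_pow, hkt, ← hw]
  have e : (w + r) / 2 + (w - r) / 2 = w := by field_simp; ring
  generalize (w + r) / 2 = a at *
  generalize (w - r) / 2 = b at *
  rw [← hp, ← e]; ring

lemma cset_pair {k d c : F} (hk : k ≠ 0) (hc : c ∈ cset k d) : cset k d = {c, k ^ 3 / c} := by
  rw [mem_cset] at hc
  obtain ⟨hc0, hcd⟩ := hc
  ext x
  rw [mem_cset, Finset.mem_insert, Finset.mem_singleton]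
  constructor
  · rintro ⟨hx0, hx⟩
    rw [← hcd] at hx
    have : (x - c) * (x * c - k ^ 3) = 0 := by
      field_simp at hx
      linear_combination hx
    rcases mul_eq_zero.mp this with h | h
    · left; linear_combination h
    · right; rw [eq_div_iff hc0]; linear_combination h
  · rintro (rfl | rfl)
    · exact ⟨hc0, hcd⟩
    · refine ⟨div_ne_zero (pow_ne_zero _ hk) hc0, ?_⟩
      rw [← hcd]; field_simp; ring

variable (ω : MulChar F ℂ) (hω : ∀ χ : MulChar F ℂ, ∃ j : ℕ, χ = ω ^ j)
include hω

omit hω in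
lemma tau_cube {τ : MulChar F ℂ} (h : τ ^ 3 = 1) {t : F} (ht : t ≠ 0) : τ (t ^ 3) = 1 := by
  rw [map_pow, ← MulChar.pow_apply' _ (by norm_num), h]
  exact MulChar.one_apply (isUnit_iff_ne_zero.mpr ht)

lemma exists_zeta (m : ℕ) (hm : 3 * m = Fintype.card F - 1) :
    ∃ ζ : F, ζ ≠ 1 ∧ ζ ^ 2 + ζ + 1 = 0 := by
  have h := count_pow ω hω 3 m (by norm_num) hm 1 one_ne_zero
  simp only [map_one, Finset.sum_const, Finset.card_range, nsmul_eq_mul, mul_one] at h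
  have h3 : (Finset.univ.filter (fun x : F => x ^ 3 = 1)).card = 3 := by exact_mod_cast h
  obtain ⟨ζ, hζ, hne⟩ := Finset.exists_mem_ne (by rw [h3]; norm_num) (1 : F)
  simp only [Finset.mem_filter, Finset.mem_univ, true_and] at hζ
  refine ⟨ζ, hne, ?_⟩
  have : (ζ - 1) * (ζ ^ 2 + ζ + 1) = 0 := by linear_combination hζ
  exact (mul_eq_zero.mp this).resolve_left (sub_ne_zero.mpr hne)

lemma wset_of_cset (m : ℕ) (hm : 3 * m = Fintype.card F - 1) (h2 : (2 : F) ≠ 0) (h3 : (3 : F) ≠ 0)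
    {k d : F} (hk : k ≠ 0) (hne : (cset k d).Nonempty) :
    ((wset k d).card : ℂ) = 1 + ∑ c ∈ cset k d, (ω ^ m) c := by
  obtain ⟨c, hc⟩ := hne
  have hpair := cset_pair hk hc
  rw [mem_cset] at hc
  obtain ⟨hc0, hcd⟩ := hc
  have hτ3 : (ω ^ m) ^ 3 = 1 := by
    rw [← pow_mul, mul_comm, hm, ← orderOf_gen ω hω, pow_orderOf_eq_one]
  have hk3 : k ^ 3 ≠ 0 := pow_ne_zero _ hk
  obtain ⟨ζ, hζ1, hζ⟩ := exists_zeta ω hω m hm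
  have hζ3 : ζ ^ 3 = 1 := by linear_combination (ζ - 1) * hζ
  by_cases hcube : ∃ t : F, t ^ 3 = c
  · by_cases hsq : c ^ 2 = k ^ 3
    · -- degenerate case
      have hkc : k ^ 3 / c = c := by rw [← hsq]; field_simp
      rw [hpair, hkc]
      set s := c / k with hs
      have hs0 : s ≠ 0 := div_ne_zero hc0 hk
      have hcs : c = s ^ 3 := by rw [hs]; field_simp; rw [← hsq]
      have hks : k = s ^ 2 := by rw [hs]; field_simp; rw [hsq]
      have hw : wset k d = {2 * s, -s} := by
        ext w
        rw [mem_wset, Finset.mem_insert, Finset.mem_singleton, ← hcd, hkc, hcs, hks]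
        constructor
        · intro h
          have : (w - 2 * s) * (w + s) ^ 2 = 0 := by linear_combination h
          rcases mul_eq_zero.mp this with h | h
          · left; linear_combination h
          · right; linear_combination pow_eq_zero_iff (two_ne_zero) |>.mp h
        · rintro (rfl | rfl) <;> ring
      have hd : 2 * s ≠ -s := by
        intro h
        have : 3 * s = 0 := by linear_combination h
        exact (mul_ne_zero h3 hs0) this
      rw [hw, Finset.card_pair hd, hcs]
      simp only [Finset.mem_singleton, Finset.insert_eq_of_mem, Finset.sum_singleton]
      rw [tau_cube hτ3 hs0]; norm_num
    · obtain ⟨t, rfl⟩ := hcube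
      have ht : t ≠ 0 := by rintro rfl; simp at hc0
      have hne : t ^ 3 ≠ k ^ 3 / t ^ 3 := by
        intro h; apply hsq; rw [eq_div_iff hc0] at h; rw [← h]; ring
      have hw : wset k d = {t + k / t, ζ * t + ζ ^ 2 * (k / t), ζ ^ 2 * t + ζ * (k / t)} := by
        ext w
        rw [mem_wset, Finset.mem_insert, Finset.mem_insert, Finset.mem_singleton, ← hcd]
        have hkt : k = t * (k / t) := by field_simp
        rw [← div_pow]
        generalize k / t = u at *
        subst hkt
        have fac : w ^ 3 - 3 * (t * u) * w - (t ^ 3 + u ^ 3) =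
            (w - (t + u)) * ((w - (ζ * t + ζ ^ 2 * u)) * (w - (ζ ^ 2 * t + ζ * u))) := by
          have z4 : ζ ^ 4 = ζ := by linear_combination ζ * hζ3
          have z2 : ζ ^ 2 = -1 - ζ := by linear_combination hζ
          have : (w - (ζ * t + ζ ^ 2 * u)) * (w - (ζ ^ 2 * t + ζ * u)) =
              w ^ 2 + w * t + w * u + t ^ 2 + u ^ 2 - t * u := by
            linear_combination (-w*t - w * u + t*u) * hζ + (t^2 + u^2) * hζ3 + t * u * z4
          rw [this]; ring
        constructor
        · intro h
          have h' := sub_eq_zero.mpr h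
          rw [fac] at h'
          rcases mul_eq_zero.mp h' with h | h
          · left; linear_combination h
          rcases mul_eq_zero.mp h with h | h
          · right; left; linear_combination h
          · right; right; linear_combination h
        · intro h
          apply sub_eq_zero.mp
          rw [fac]
          rcases h with h | h | h <;> rw [h] <;> ring
      have hz1 : ζ - 1 ≠ 0 := sub_ne_zero.mpr hζ1
      have hz0 : ζ ≠ 0 := by rintro rfl; simp at hζ
      have key : ∀ i : F, i ^ 3 = 1 → t ^ 2 ≠ i * k := by
        intro i hi h
        apply hsq
        calc (t ^ 3) ^ 2 = (t ^ 2) ^ 3 := by ring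
          _ = k ^ 3 := by rw [h, mul_pow, hi, one_mul]
      have d1 : t + k / t ≠ ζ * t + ζ ^ 2 * (k / t) := by
        intro h
        apply key (ζ ^ 2) (by rw [← pow_mul, mul_comm, pow_mul, hζ3, one_pow])
        field_simp at h
        apply mul_left_cancel₀ hz1
        linear_combination -h - k * hζ3
      have d2 : t + k / t ≠ ζ ^ 2 * t + ζ * (k / t) := by
        intro h
        apply key ζ hζ3
        field_simp at h
        apply mul_left_cancel₀ hz1
        have : (ζ ^ 2 - 1) * t ^ 2 = (1 - ζ) * k := by linear_combination -h
        have h5 : (ζ - 1) * ((ζ + 1) * t ^ 2 + k) = 0 := by linear_combination this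
        have h6 := (mul_eq_zero.mp h5).resolve_left hz1
        linear_combination (-(ζ - 1) * ζ) * h6 + (ζ-1) * t ^ 2 * hζ
      have d3 : ζ * t + ζ ^ 2 * (k / t) ≠ ζ ^ 2 * t + ζ * (k / t) := by
        intro h
        apply key 1 (one_pow 3)
        field_simp at h
        apply mul_left_cancel₀ hz1
        have h5 : ζ * ((ζ - 1) * (t ^ 2 - k)) = 0 := by linear_combination -h * ζ
        have h6 := (mul_eq_zero.mp h5).resolve_left hz0
        linear_combination h6
      rw [hw, hpair, Finset.sum_pair hne, tau_cube hτ3 ht, ← div_pow,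
        tau_cube hτ3 (div_ne_zero hk ht), Finset.card_eq_three.mpr ⟨_, _, _, d1, d2, d3, rfl⟩]
      norm_num
  · -- `c` is not a cube
    have hcnt := count_pow ω hω 3 m (by norm_num) hm c hc0
    have hempty : Finset.univ.filter (fun x : F => x ^ 3 = c) = ∅ := by
      ext x; simp; exact fun h => hcube ⟨x, h⟩
    rw [hempty] at hcnt
    have hne : c ≠ k ^ 3 / c := by
      intro h
      apply hcube
      refine ⟨c / k, ?_⟩
      rw [eq_div_iff hc0] at h
      rw [div_pow, ← h]; field_simp
    have hinv : (ω ^ m) (k ^ 3 / c) = ((ω ^ m) ^ 2) c := by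
      have h1 : (ω ^ m) (k ^ 3 / c) = (ω ^ m)⁻¹ c := by
        rw [div_eq_mul_inv, map_mul, tau_cube hτ3 hk, one_mul, MulChar.inv_apply']
      rw [h1]
      congr 1
      rw [inv_eq_iff_mul_eq_one, ← pow_succ', hτ3]
    have hw : wset k d = ∅ := by
      ext w
      rw [mem_wset]
      simp only [Finset.notMem_empty, iff_false]
      intro hw
      have hdisc : (w ^ 2 - 4 * k) * (w ^ 2 - k) ^ 2 = (c - k ^ 3 / c) ^ 2 := by
        have e1 : c * (k ^ 3 / c) = k ^ 3 := by field_simp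
        generalize k ^ 3 / c = u at *
        linear_combination (w^3 - 3*k*w + c + u) * (hw.trans hcd.symm) + 4 * e1
      by_cases hwk : w ^ 2 - k = 0
      · rw [hwk] at hdisc
        apply hne
        have : (c - k ^ 3 / c) ^ 2 = 0 := by rw [← hdisc]; ring
        have := pow_eq_zero_iff (two_ne_zero) |>.mp this
        linear_combination this
      · obtain ⟨t, ht, htd⟩ := cset_of_square (r := (c - k ^ 3 / c) / (w ^ 2 - k)) h2 hk hw
          (by rw [div_pow, ← hdisc]; field_simp)
        have : t ^ 3 ∈ cset k d := mem_cset.mpr ⟨pow_ne_zero _ ht, htd⟩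
        rw [hpair, Finset.mem_insert, Finset.mem_singleton] at this
        rcases this with h | h
        · exact hcube ⟨t, h⟩
        · apply hcube
          refine ⟨k / t, ?_⟩
          rw [div_pow, h]; field_simp
    rw [hw, hpair, Finset.sum_pair hne, hinv]
    rw [Finset.sum_range_succ, Finset.sum_range_succ, Finset.sum_range_succ, Finset.sum_range_zero] at hcnt
    simp only [pow_zero, pow_one, MulChar.one_apply (isUnit_iff_ne_zero.mpr hc0)] at hcnt
    rw [Finset.card_empty, Nat.cast_zero] at hcnt ⊢
    linear_combination hcnt

end tripl

section tripl2

variable {F : Type} [Field F] [Fintype F]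
variable (ω : MulChar F ℂ) (hω : ∀ χ : MulChar F ℂ, ∃ j : ℕ, χ = ω ^ j)
include hω

lemma wset_card_le (m : ℕ) (hm : 3 * m = Fintype.card F - 1) (h2 : (2 : F) ≠ 0) (h3 : (3 : F) ≠ 0)
    {k d : F} (hk : k ≠ 0) (he : cset k d = ∅) : (wset k d).card ≤ 1 := by
  obtain ⟨ζ, hζ1, hζ⟩ := exists_zeta ω hω m hm
  rw [Finset.card_le_one]
  intro w hw w' hw'
  rw [mem_wset] at hw hw'
  by_contra hne
  have hq : w ^ 2 + w * w' + w' ^ 2 = 3 * k := by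
    have : (w - w') * (w ^ 2 + w * w' + w' ^ 2 - 3 * k) = 0 := by
      linear_combination hw - hw'
    have := (mul_eq_zero.mp this).resolve_left (sub_ne_zero.mpr hne)
    linear_combination this
  have hz : (2 * ζ + 1) ^ 2 = -3 := by linear_combination 4 * hζ
  have hz0 : 2 * ζ + 1 ≠ 0 := by
    intro h
    rw [h] at hz
    apply h3
    linear_combination hz
  obtain ⟨t, ht, htd⟩ := cset_of_square (r := (2 * w' + w) / (2 * ζ + 1)) h2 hk hw (by
    rw [div_pow, hz]
    field_simp
    linear_combination 4 * hq)
  have : t ^ 3 ∈ cset k d := mem_cset.mpr ⟨pow_ne_zero _ ht, htd⟩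
  rw [he] at this
  simp at this

lemma sum_cset (k : F) (f : F → F → ℂ) :
    ∑ d : F, ∑ c ∈ cset k d, f c d =
      ∑ c ∈ Finset.univ.filter (fun c : F => c ≠ 0), f c (c + k ^ 3 / c) := by
  simp_rw [cset, Finset.sum_filter]
  rw [Finset.sum_comm]
  refine Finset.sum_congr rfl fun c _ => ?_
  by_cases hc : c = 0
  · simp [hc]
  · simp [hc]

lemma sum_wset (k : F) (f : F → ℂ) :
    ∑ d : F, ((wset k d).card : ℂ) * f d = ∑ w : F, f (w ^ 3 - 3 * k * w) := by
  simp_rw [wset, Finset.card_filter]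
  push_cast
  simp_rw [Finset.sum_mul]
  rw [Finset.sum_comm]
  refine Finset.sum_congr rfl fun w _ => ?_
  simp

lemma wset_card (m : ℕ) (hm : 3 * m = Fintype.card F - 1) (h2 : (2 : F) ≠ 0) (h3 : (3 : F) ≠ 0)
    {k : F} (hk : k ≠ 0) (d : F) :
    ((wset k d).card : ℂ) = 1 + ∑ c ∈ cset k d, (ω ^ m) c := by
  by_cases hd : (cset k d).Nonempty
  · exact wset_of_cset ω hω m hm h2 h3 hk hd
  have hτ1 : ω ^ m ≠ 1 := by
    intro h
    have := orderOf_gen_pow ω hω 3 m hm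
    rw [h, orderOf_one] at this
    norm_num at this
  set N := Finset.univ.filter (fun d : F => ¬ (cset k d).Nonempty) with hN
  have tot : ∑ d : F, (((wset k d).card : ℂ) - 1 - ∑ c ∈ cset k d, (ω ^ m) c) = 0 := by
    rw [Finset.sum_sub_distrib, Finset.sum_sub_distrib]
    have e1 := sum_wset ω hω k (fun _ => (1 : ℂ))
    simp only [mul_one] at e1
    rw [e1, sum_cset ω hω k (fun c _ => (ω ^ m) c), sub_self, zero_sub, neg_eq_zero,
      Finset.sum_filter]
    refine Eq.trans ?_ (MulChar.sum_eq_zero_of_ne_one hτ1)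
    refine Finset.sum_congr rfl fun c _ => ?_
    by_cases hc : c = 0 <;> simp [hc, MulChar.map_zero]
  have tot2 : ∑ d ∈ N, (((wset k d).card : ℂ) - 1) = 0 := by
    rw [← tot, hN, Finset.sum_filter]
    refine Finset.sum_congr rfl fun d _ => ?_
    by_cases h : (cset k d).Nonempty
    · rw [if_neg (not_not.mpr h), wset_of_cset ω hω m hm h2 h3 hk h]; ring
    · rw [if_pos h]
      rw [Finset.not_nonempty_iff_eq_empty] at h
      rw [h]; simp
  have tot3 : ∑ d ∈ N, (wset k d).card = ∑ d ∈ N, 1 := by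
    rw [Finset.sum_sub_distrib, sub_eq_zero] at tot2
    exact_mod_cast tot2
  have hall := (Finset.sum_eq_sum_iff_of_le (fun d hd => by
    have : ¬ (cset k d).Nonempty := by simpa [hN] using hd
    exact wset_card_le ω hω m hm h2 h3 hk (Finset.not_nonempty_iff_eq_empty.mp this))).mp tot3
  rw [hall d (by simp [hN]; exact Finset.not_nonempty_iff_eq_empty.mp hd),
    Finset.not_nonempty_iff_eq_empty.mp hd]
  simp

lemma airy (m : ℕ) (hm : 3 * m = Fintype.card F - 1) (h2 : (2 : F) ≠ 0) (h3 : (3 : F) ≠ 0)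
    {ψ : AddChar F ℂ} (hψ : ψ ≠ 1) (β : F) (hβ : β ≠ 0) :
    ∑ w : F, ψ (w ^ 3 / β - 3 * w) =
      (ω ^ m) β * ∑ c ∈ Finset.univ.filter (fun c : F => c ≠ 0), (ω ^ m) c * ψ (c + β / c) := by
  have hτ3 : (ω ^ m) ^ 3 = 1 := by
    rw [← pow_mul, mul_comm, hm, ← orderOf_gen ω hω, pow_orderOf_eq_one]
  have hk : β⁻¹ ≠ 0 := inv_ne_zero hβ
  have e1 : ∑ w : F, ψ (w ^ 3 / β - 3 * w) = ∑ w : F, ψ (β ^ 2 * (w ^ 3 - 3 * β⁻¹ * w)) := by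
    symm
    refine Fintype.sum_equiv (Equiv.mulLeft₀ β hβ) _ _ fun w => ?_
    congr 1
    simp only [Equiv.mulLeft₀_apply]
    field_simp
  rw [e1, ← sum_wset ω hω β⁻¹ (fun d => ψ (β ^ 2 * d))]
  simp_rw [wset_card ω hω m hm h2 h3 hk, add_mul, one_mul, Finset.sum_mul]
  rw [Finset.sum_add_distrib, sum_add_shift hψ, if_neg (pow_ne_zero 2 hβ), zero_add,
    sum_cset ω hω β⁻¹ (fun c d => (ω ^ m) c * ψ (β ^ 2 * d)), Finset.mul_sum]
  have hβ2 : β ^ 2 ≠ 0 := pow_ne_zero 2 hβ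
  refine Finset.sum_bij (fun c _ => β ^ 2 * c) ?_ ?_ ?_ ?_
  · intro c hc
    simp only [Finset.mem_filter, Finset.mem_univ, true_and] at hc ⊢
    exact mul_ne_zero hβ2 hc
  · intro a _ b _ h
    exact mul_left_cancel₀ hβ2 h
  · intro b hb
    simp only [Finset.mem_filter, Finset.mem_univ, true_and] at hb
    refine ⟨b / β ^ 2, ?_, ?_⟩
    · simp only [Finset.mem_filter, Finset.mem_univ, true_and]
      exact div_ne_zero hb hβ2
    · field_simp
  · intro c hc
    simp only [Finset.mem_filter, Finset.mem_univ, true_and] at hc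
    have hb : (ω ^ m) β * (ω ^ m) (β ^ 2) = 1 := by
      rw [← map_mul, ← pow_succ', tau_cube hτ3 hβ]
    rw [map_mul (ω ^ m), ← mul_assoc, ← mul_assoc, hb, one_mul]
    congr 2
    field_simp

lemma gauss_trip_aux (m : ℕ) (hm : 3 * m = Fintype.card F - 1) (h2 : (2 : F) ≠ 0)
    (h3 : (3 : F) ≠ 0) {ψ : AddChar F ℂ} (hψ : ψ ≠ 1) (χ : MulChar F ℂ)
    (hχ : χ * (ω ^ m) ^ 2 ≠ 1) :
    gaussSum χ ψ * gaussSum (χ * ω ^ m) ψ =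
      (χ ^ 3)⁻¹ (-3) * gaussSum (χ ^ 3) ψ * gaussSum (χ * (ω ^ m) ^ 2)⁻¹ ψ := by
  have hτ3 : (ω ^ m) ^ 3 = 1 := by
    rw [← pow_mul, mul_comm, hm, ← orderOf_gen ω hω, pow_orderOf_eq_one]
  set τ := ω ^ m with hτ
  have lhs : gaussSum χ ψ * gaussSum (χ * τ) ψ = ∑ β : F, χ β *
      ∑ c ∈ Finset.univ.filter (fun c : F => c ≠ 0), τ c * ψ (c + β / c) := by
    simp_rw [Finset.mul_sum]
    rw [Finset.sum_comm]
    conv_lhs => rw [gaussSum.eq_def (χ * τ), Finset.mul_sum]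
    rw [Finset.sum_filter]
    refine Finset.sum_congr rfl fun c _ => ?_
    split_ifs with hc
    · have h := gs_shift χ ψ c⁻¹ (inv_ne_zero hc)
      rw [MulChar.inv_apply', inv_inv] at h
      rw [MulChar.mul_apply]
      calc gaussSum χ ψ * (χ c * τ c * ψ c) = (χ c * gaussSum χ ψ) * (τ c * ψ c) := by ring
        _ = _ := by
          rw [← h, Finset.sum_mul]
          refine Finset.sum_congr rfl fun β _ => ?_
          rw [AddChar.map_add_eq_mul, div_eq_inv_mul]
          ring
    · push Not at hc
      subst hc
      simp [MulChar.map_zero]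
  have rhs : ∑ β : F, (χ * τ ^ 2) β * ∑ w : F, ψ (w ^ 3 / β - 3 * w) =
      (χ ^ 3)⁻¹ (-3) * gaussSum (χ ^ 3) ψ * gaussSum (χ * τ ^ 2)⁻¹ ψ := by
    simp_rw [Finset.mul_sum]
    rw [Finset.sum_comm, ← gs_shift (χ ^ 3) ψ (-3) (neg_ne_zero.mpr h3), Finset.sum_mul]
    refine Finset.sum_congr rfl fun w _ => ?_
    by_cases hw : w = 0
    · subst hw
      simp only [ne_eq, OfNat.ofNat_ne_zero, not_false_eq_true, zero_pow, zero_div, mul_zero,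
        sub_zero, AddChar.map_zero_eq_one, mul_one, MulChar.map_zero, zero_mul]
      exact MulChar.sum_eq_zero_of_ne_one hχ
    · have hw3 : w ^ 3 ≠ 0 := pow_ne_zero 3 hw
      have h := gs_shift (χ * τ ^ 2)⁻¹ ψ (w ^ 3) hw3
      rw [inv_inv] at h
      have hc : (χ * τ ^ 2) (w ^ 3) = (χ ^ 3) w := by
        rw [MulChar.mul_apply, MulChar.pow_apply' τ (by norm_num), tau_cube hτ3 hw,
          MulChar.pow_apply' χ (by norm_num), map_pow, one_pow, mul_one]
      rw [hc] at h
      have h' : ∑ β : F, (χ * τ ^ 2) β * ψ (w ^ 3 / β) =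
          (χ ^ 3) w * gaussSum (χ * τ ^ 2)⁻¹ ψ := by
        rw [← h]
        refine Fintype.sum_equiv (Equiv.inv F) _ _ fun β => ?_
        simp only [Equiv.inv_apply]
        rw [MulChar.inv_apply', inv_inv, div_eq_mul_inv]
      calc _ = (∑ β : F, (χ * τ ^ 2) β * ψ (w ^ 3 / β)) * ψ (-3 * w) := by
            rw [Finset.sum_mul]
            refine Finset.sum_congr rfl fun β _ => ?_
            rw [sub_eq_add_neg, AddChar.map_add_eq_mul, neg_mul, mul_assoc]
        _ = _ := by rw [h']; ring
  rw [lhs, ← rhs]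
  refine Finset.sum_congr rfl fun β _ => ?_
  by_cases hβ : β = 0
  · subst hβ; simp only [MulChar.map_zero, zero_mul]
  · rw [airy ω hω m hm h2 h3 hψ β hβ, MulChar.mul_apply, ← hτ]
    have : (τ ^ 2) β * τ β = 1 := by
      rw [← MulChar.mul_apply, ← pow_succ, hτ3, MulChar.one_apply (isUnit_iff_ne_zero.mpr hβ)]
    generalize (∑ c ∈ Finset.univ.filter (fun c : F => c ≠ 0), τ c * ψ (c + β / c)) = S
    linear_combination (-χ β * S) * this

lemma gauss_trip (m : ℕ) (hm : 3 * m = Fintype.card F - 1) (h2 : (2 : F) ≠ 0)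
    (h3 : (3 : F) ≠ 0) {ψ : AddChar F ℂ} (hψ : ψ ≠ 1) (χ : MulChar F ℂ) :
    gaussSum χ ψ * gaussSum (χ * ω ^ m) ψ * gaussSum (χ * (ω ^ m) ^ 2) ψ * χ 27 =
      Fintype.card F * gaussSum (χ ^ 3) ψ := by
  have hτ3 : (ω ^ m) ^ 3 = 1 := by
    rw [← pow_mul, mul_comm, hm, ← orderOf_gen ω hω, pow_orderOf_eq_one]
  have hτ1 : ω ^ m ≠ 1 := by
    intro h
    have := orderOf_gen_pow ω hω 3 m hm
    rw [h, orderOf_one] at this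
    norm_num at this
  have h27 : (27 : F) = 3 ^ 3 := by norm_num
  have hm1 : (ω ^ m) (-1) = 1 := by
    have := tau_cube hτ3 (t := (-1 : F)) (by norm_num)
    rwa [show (-1 : F) ^ 3 = -1 by norm_num] at this
  by_cases hχ : χ * (ω ^ m) ^ 2 = 1
  · have hχ' : χ = ω ^ m := by
      calc χ = χ * (ω ^ m) ^ 2 * (ω ^ m) := by rw [mul_assoc, ← pow_succ, hτ3, mul_one]
        _ = ω ^ m := by rw [hχ, one_mul]
    rw [hχ, hχ', hτ3, h27, tau_cube hτ3 h3]
    have hinv : ω ^ m * ω ^ m = (ω ^ m)⁻¹ := by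
      rw [eq_inv_iff_mul_eq_one, ← pow_two, ← pow_succ, hτ3]
    rw [hinv, gs_mul_inv hψ hτ1, hm1]
    ring
  · have h := gauss_trip_aux ω hω m hm h2 h3 hψ χ hχ
    have hi := gs_mul_inv hψ hχ
    have e : (χ * (ω ^ m) ^ 2) (-1) = χ (-1) := by
      rw [MulChar.mul_apply, MulChar.pow_apply' _ (by norm_num), hm1, one_pow, mul_one]
    rw [e] at hi
    have e2 : (χ ^ 3)⁻¹ (-3) * (χ (-1) * χ 27) = 1 := by
      rw [← map_mul, show (-1 : F) * 27 = (-3) ^ 3 by norm_num, map_pow,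
        ← MulChar.pow_apply' _ (by norm_num), ← MulChar.mul_apply, inv_mul_cancel,
        MulChar.one_apply (isUnit_iff_ne_zero.mpr (neg_ne_zero.mpr h3))]
    rw [h]
    calc _ = (χ ^ 3)⁻¹ (-3) * gaussSum (χ ^ 3) ψ * χ 27 * (gaussSum (χ * (ω ^ m) ^ 2) ψ *
          gaussSum (χ * (ω ^ m) ^ 2)⁻¹ ψ) := by ring
      _ = ((χ ^ 3)⁻¹ (-3) * (χ (-1) * χ 27)) * (Fintype.card F * gaussSum (χ ^ 3) ψ) := by
          rw [hi]; ring
      _ = _ := by rw [e2, one_mul]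

/-- The Hasse–Davenport product formula for `6`. -/
lemma gauss_six (t : ℕ) (ht : 6 * t = Fintype.card F - 1) (h2 : (2 : F) ≠ 0)
    (h3 : (3 : F) ≠ 0) {ψ : AddChar F ℂ} (hψ : ψ ≠ 1) (χ : MulChar F ℂ) :
    (gaussSum χ ψ * gaussSum (χ * ω ^ t) ψ * gaussSum (χ * (ω ^ t) ^ 2) ψ *
      gaussSum (χ * (ω ^ t) ^ 3) ψ * gaussSum (χ * (ω ^ t) ^ 4) ψ *
      gaussSum (χ * (ω ^ t) ^ 5) ψ) * (χ ^ 6) 6 =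
      Fintype.card F * gaussSum ((ω ^ t) ^ 3) ψ ^ 3 * gaussSum (χ ^ 6) ψ := by
  have hm2 : 2 * (3 * t) = Fintype.card F - 1 := by omega
  have hm3 : 3 * (2 * t) = Fintype.card F - 1 := by omega
  have h6 : (6 : F) ≠ 0 := by
    rw [show (6 : F) = 2 * 3 by norm_num]; exact mul_ne_zero h2 h3
  have hord : (ω ^ t) ^ 6 = 1 := by
    rw [← pow_mul, mul_comm, ht, ← orderOf_gen ω hω, pow_orderOf_eq_one]
  have p2 : ω ^ (3 * t) = (ω ^ t) ^ 3 := by rw [← pow_mul, mul_comm]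
  have p3 : ω ^ (2 * t) = (ω ^ t) ^ 2 := by rw [← pow_mul, mul_comm]
  have d0 := gauss_dup ω hω (3 * t) hm2 h2 hψ χ
  have d1 := gauss_dup ω hω (3 * t) hm2 h2 hψ (χ * (ω ^ t) ^ 2)
  have d2 := gauss_dup ω hω (3 * t) hm2 h2 hψ (χ * (ω ^ t) ^ 4)
  have tr := gauss_trip ω hω (2 * t) hm3 h2 h3 hψ (χ ^ 2)
  rw [p2] at d0 d1 d2
  rw [p3] at tr
  generalize ω ^ t = τ at *
  have a1 : χ * τ ^ 2 * τ ^ 3 = χ * τ ^ 5 := by rw [mul_assoc, ← pow_add]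
  have a2 : χ * τ ^ 4 * τ ^ 3 = χ * τ := by
    rw [mul_assoc, ← pow_add, show 4 + 3 = 6 + 1 by norm_num, pow_succ, hord, one_mul]
  have a3 : (χ * τ ^ 2) ^ 2 = χ ^ 2 * (τ ^ 2) ^ 2 := by rw [mul_pow]
  have a4 : (χ * τ ^ 4) ^ 2 = χ ^ 2 * τ ^ 2 := by
    rw [mul_pow, ← pow_mul, show 4 * 2 = 6 + 2 by norm_num, pow_add, hord, one_mul]
  have a5 : (χ ^ 2) ^ 3 = χ ^ 6 := by rw [← pow_mul]
  rw [a1, a3] at d1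
  rw [a2, a4] at d2
  rw [a5] at tr
  have v : (χ ^ 6) 6 = χ 4 * (χ * τ ^ 2) 4 * (χ * τ ^ 4) 4 * (χ ^ 2) 27 := by
    have h4 : (4 : F) ≠ 0 := by
      rw [show (4 : F) = 2 * 2 by norm_num]; exact mul_ne_zero h2 h2
    have e : χ 4 * (χ * τ ^ 2) 4 * (χ * τ ^ 4) 4 = χ 4 * χ 4 * χ 4 * (τ ^ 6) 4 := by
      rw [MulChar.mul_apply, MulChar.mul_apply, show (6 : ℕ) = 2 + 4 by norm_num, pow_add τ 2 4,
        MulChar.mul_apply]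
      ring
    rw [e, hord, MulChar.one_apply (isUnit_iff_ne_zero.mpr h4), mul_one,
      MulChar.pow_apply' _ (by norm_num), MulChar.pow_apply' _ (by norm_num)]
    rw [← map_pow, ← map_pow, ← map_mul, ← map_mul, ← map_mul]
    congr 1; norm_num
  rw [v]
  calc _ = (gaussSum χ ψ * gaussSum (χ * τ ^ 3) ψ * χ 4) *
        (gaussSum (χ * τ ^ 2) ψ * gaussSum (χ * τ ^ 5) ψ * (χ * τ ^ 2) 4) *
        (gaussSum (χ * τ ^ 4) ψ * gaussSum (χ * τ) ψ * (χ * τ ^ 4) 4) * (χ ^ 2) 27 := by ring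
    _ = (gaussSum (χ ^ 2) ψ * gaussSum (χ ^ 2 * τ ^ 2) ψ * gaussSum (χ ^ 2 * (τ ^ 2) ^ 2) ψ *
        (χ ^ 2) 27) * gaussSum (τ ^ 3) ψ ^ 3 := by rw [d0, d1, d2]; ring
    _ = _ := by rw [tr]; ring

end tripl2

section proj

variable {F : Type} [Field F] [Fintype F]

lemma dwork_affine (lam : F) :
    (((Fintype.card F : ℂ) - 1)) * (dworkCount F 6 lam : ℂ) + 1 =
      ((Finset.univ.filter (fun v : Fin 6 → F =>
        ∑ i, v i ^ 6 = 6 * lam * ∏ i, v i)).card : ℂ) := by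
  have hom : ∀ (u : F), u ≠ 0 → ∀ v : Fin 6 → F,
      (∑ i, (u • v) i ^ 6 = 6 * lam * ∏ i, (u • v) i) ↔ (∑ i, v i ^ 6 = 6 * lam * ∏ i, v i) := by
    intro u hu v
    simp only [Pi.smul_apply, smul_eq_mul, mul_pow, Finset.prod_mul_distrib, ← Finset.mul_sum,
      Finset.prod_const, Finset.card_univ, Fintype.card_fin]
    rw [show 6 * lam * (u ^ 6 * ∏ i, v i) = u ^ 6 * (6 * lam * ∏ i, v i) by ring]
    exact mul_right_inj' (pow_ne_zero 6 hu)
  let S := {P : Projectivization F (Fin 6 → F) // ∑ i, P.rep i ^ 6 = ((6 : ℕ) : F) * lam * ∏ i, P.rep i}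
  let T := {v : Fin 6 → F // v ≠ 0 ∧ ∑ i, v i ^ 6 = 6 * lam * ∏ i, v i}
  let f : S × Fˣ → T := fun x => ⟨(x.2 : F) • x.1.1.rep,
    smul_ne_zero x.2.ne_zero x.1.1.rep_nonzero, by
      rw [hom _ x.2.ne_zero]; have := x.1.2; push_cast at this; exact this⟩
  have hf : Function.Bijective f := by
    constructor
    · rintro ⟨⟨P, hP⟩, u⟩ ⟨⟨P', hP'⟩, u'⟩ h
      have h' : (u : F) • P.rep = (u' : F) • P'.rep := congrArg Subtype.val h
      have hPP : P = P' := by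
        rw [← P.mk_rep, ← P'.mk_rep, Projectivization.mk_eq_mk_iff]
        refine ⟨u⁻¹ * u', ?_⟩
        rw [mul_smul, Units.smul_def u', ← h', ← Units.smul_def u, inv_smul_smul]
      subst hPP
      have : (u : F) = u' := smul_left_injective F P.rep_nonzero h'
      have : u = u' := Units.ext this
      subst this
      rfl
    · rintro ⟨v, hv, he⟩
      obtain ⟨a, ha⟩ := Projectivization.exists_smul_eq_mk_rep F v hv
      refine ⟨⟨⟨Projectivization.mk F v hv, ?_⟩, a⁻¹⟩, ?_⟩
      · rw [← ha, Units.smul_def]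
        push_cast
        rwa [hom _ a.ne_zero]
      · apply Subtype.ext
        change ((a⁻¹ : Fˣ) : F) • (Projectivization.mk F v hv).rep = v
        rw [← ha, ← Units.smul_def, inv_smul_smul]
  have h1 := Nat.card_congr (Equiv.ofBijective f hf)
  rw [Nat.card_prod, Nat.card_eq_fintype_card (α := Fˣ), Fintype.card_units] at h1
  have h2 : (Finset.univ.filter (fun v : Fin 6 → F =>
        ∑ i, v i ^ 6 = 6 * lam * ∏ i, v i)).card = Nat.card T + 1 := by
    rw [Nat.card_eq_fintype_card, Fintype.card_subtype]
    have : Finset.univ.filter (fun v : Fin 6 → F => ∑ i, v i ^ 6 = 6 * lam * ∏ i, v i) =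
        insert 0 (Finset.univ.filter (fun v : Fin 6 → F =>
          v ≠ 0 ∧ ∑ i, v i ^ 6 = 6 * lam * ∏ i, v i)) := by
      ext v
      simp only [Finset.mem_filter, Finset.mem_univ, true_and, Finset.mem_insert]
      constructor
      · intro h; by_cases hv : v = 0
        · exact Or.inl hv
        · exact Or.inr ⟨hv, h⟩
      · rintro (rfl | h)
        · simp
        · exact h.2
    rw [this, Finset.card_insert_of_notMem (by simp)]
  rw [h2, ← h1]
  have : dworkCount F 6 lam = Nat.card S := rfl
  rw [this]
  push_cast [Nat.cast_sub (Fintype.card_pos (α := F))]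
  ring

end proj

section affine

/-- Cyclic convolution modulo six. -/
noncomputable def conv6 (h k : Fin 6 → ℂ) : Fin 6 → ℂ := fun r => ∑ a, h a * k (r - a)

/-- The sum over `w ∈ (ℤ/6)⁶` with `∑ w = 0` of `∏ h (w i)`. -/
noncomputable def P6 (h : Fin 6 → ℂ) : ℂ :=
  conv6 (conv6 (conv6 h h) h) (conv6 (conv6 h h) h) 0

lemma pow_fin_add (z : ℂ) (hz : z ^ 6 = 1) (a b : Fin 6) :
    z ^ ((a + b : Fin 6) : ℕ) = z ^ (a : ℕ) * z ^ (b : ℕ) := by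
  rw [Fin.val_add, ← pow_add]
  conv_rhs => rw [← Nat.mod_add_div ((a : ℕ) + b) 6]
  rw [pow_add, pow_mul, hz, one_pow, mul_one]

lemma ev_conv6 (z : ℂ) (hz : z ^ 6 = 1) (h k : Fin 6 → ℂ) :
    (∑ a, h a * z ^ (a : ℕ)) * (∑ a, k a * z ^ (a : ℕ)) = ∑ a, conv6 h k a * z ^ (a : ℕ) := by
  simp_rw [conv6, Finset.sum_mul]
  rw [Finset.sum_comm]
  refine Finset.sum_congr rfl fun a _ => ?_
  rw [Finset.mul_sum]
  refine Fintype.sum_equiv (Equiv.addLeft a) _ _ fun b => ?_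
  simp only [Equiv.coe_addLeft]
  rw [pow_fin_add z hz, add_sub_cancel_left]
  ring

lemma ev_pow6 (z : ℂ) (hz : z ^ 6 = 1) (h : Fin 6 → ℂ) :
    (∑ a, h a * z ^ (a : ℕ)) ^ 6 =
      ∑ a, conv6 (conv6 (conv6 h h) h) (conv6 (conv6 h h) h) a * z ^ (a : ℕ) := by
  rw [← ev_conv6 z hz, ← ev_conv6 z hz, ← ev_conv6 z hz]
  ring

variable {F : Type} [Field F] [Fintype F]

lemma sum_units (f : F → ℂ) : ∑ x, f x = f 0 + ∑ u : Fˣ, f u := by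
  rw [← Finset.add_sum_erase _ f (Finset.mem_univ 0)]
  congr 1
  symm
  refine Finset.sum_bij (fun u _ => (u : F)) ?_ ?_ ?_ ?_
  · intro u _; simp
  · intro a _ b _ h; exact Units.ext h
  · intro b hb
    have hb0 : b ≠ 0 := by simpa using hb
    exact ⟨Units.mk0 b hb0, Finset.mem_univ _, rfl⟩
  · intro u _; rfl

lemma sum_all_units (f g : (Fin 6 → F) → ℂ) (h : ∀ v, (∃ i, v i = 0) → f v = g v) :
    ∑ v, f v - ∑ v : Fin 6 → Fˣ, f (fun i => v i) =
      ∑ v, g v - ∑ v : Fin 6 → Fˣ, g (fun i => v i) := by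
  have key : ∀ f : (Fin 6 → F) → ℂ, ∑ v, f v - ∑ v : Fin 6 → Fˣ, f (fun i => v i) =
      ∑ v ∈ Finset.univ.filter (fun v : Fin 6 → F => ∃ i, v i = 0), f v := by
    intro f
    rw [← Finset.sum_filter_add_sum_filter_not Finset.univ (fun v : Fin 6 → F => ∃ i, v i = 0) f]
    have : ∑ v ∈ Finset.univ.filter (fun v : Fin 6 → F => ¬ ∃ i, v i = 0), f v =
        ∑ v : Fin 6 → Fˣ, f (fun i => v i) := by
      symm
      refine Finset.sum_bij (fun v _ i => (v i : F)) ?_ ?_ ?_ ?_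
      · intro v _; simp
      · intro a _ b _ hab
        funext i
        exact Units.ext (congrFun hab i)
      · intro b hb
        have hb0 : ∀ i, b i ≠ 0 := by simpa using hb
        exact ⟨fun i => Units.mk0 (b i) (hb0 i), Finset.mem_univ _, rfl⟩
      · intro u _; rfl
    rw [this]; ring
  rw [key, key]
  refine Finset.sum_congr rfl fun v hv => h v ?_
  simpa using hv

variable {τ : MulChar F ℂ} (hord : orderOf τ = 6)
  (hcnt : ∀ u : F, u ≠ 0 → ((Finset.univ.filter (fun x : F => x ^ 6 = u)).card : ℂ) =
    ∑ a : Fin 6, (τ ^ (a : ℕ)) u)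

include hord in
lemma tau_unit_pow6 (z : Fˣ) : (τ (z : F)) ^ 6 = 1 := by
  rw [← MulChar.pow_apply_coe, ← hord, pow_orderOf_eq_one, MulChar.one_apply_coe]

include hord in
lemma sum_units_ev (k : Fin 6 → ℂ) :
    ∑ z : Fˣ, ∑ a, k a * (τ (z : F)) ^ (a : ℕ) = ((Fintype.card F : ℂ) - 1) * k 0 := by
  rw [Finset.sum_comm]
  simp_rw [← Finset.mul_sum]
  have key : ∀ a : Fin 6, ∑ z : Fˣ, (τ (z : F)) ^ (a : ℕ) =
      if a = 0 then (Fintype.card F : ℂ) - 1 else 0 := by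
    intro a
    have h := char_sum (τ ^ (a : ℕ))
    rw [sum_units, MulChar.map_zero, zero_add] at h
    simp_rw [MulChar.pow_apply_coe] at h
    rw [h]
    have : (τ ^ (a : ℕ) = 1) ↔ a = 0 := by
      rw [← orderOf_dvd_iff_pow_eq_one, hord]
      constructor
      · intro hd
        have := Nat.eq_zero_of_dvd_of_lt hd a.2
        exact Fin.ext this
      · rintro rfl; simp
    simp only [this]
  simp_rw [key]
  simp
  ring

include hord in
lemma sum_units_pow6 (k : Fin 6 → ℂ) :
    ∑ z : Fˣ, (∑ a, k a * (τ (z : F)) ^ (a : ℕ)) ^ 6 = ((Fintype.card F : ℂ) - 1) * P6 k := by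
  simp_rw [fun z : Fˣ => ev_pow6 _ (tau_unit_pow6 hord z) k]
  rw [sum_units_ev hord, P6]

include hord hcnt in
lemma sixth_sum (ψ : AddChar F ℂ) (η : MulChar F ℂ) (z : Fˣ) :
    η z * ∑ x : Fˣ, η ((x : F) ^ 6) * ψ (z * (x : F) ^ 6) =
      ∑ a : Fin 6, gaussSum (η * (τ⁻¹) ^ (a : ℕ)) ψ * (τ (z : F)) ^ (a : ℕ) := by
  have hcnt' : ∀ u : F, u ≠ 0 → ((Finset.univ.filter (fun x : F => x ^ 6 = u)).card : ℂ) =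
      ∑ a : Fin 6, (τ⁻¹ ^ (a : ℕ)) u := by
    intro u hu
    have h := hcnt u⁻¹ (inv_ne_zero hu)
    rw [show ∑ a : Fin 6, (τ⁻¹ ^ (a : ℕ)) u = ∑ a : Fin 6, (τ ^ (a : ℕ)) u⁻¹ by
      refine Finset.sum_congr rfl fun a _ => ?_
      rw [inv_pow, MulChar.inv_apply'], ← h]
    congr 1
    refine Finset.card_bij (fun x _ => x⁻¹) ?_ ?_ ?_
    · intro x hx; simp at hx ⊢; rw [hx]
    · intro a _ b _ hab; exact inv_injective hab
    · intro b hb; simp at hb; exact ⟨b⁻¹, by simp [hb], inv_inv b⟩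
  have e1 : ∑ x : Fˣ, η ((x : F) ^ 6) * ψ (z * (x : F) ^ 6) =
      ∑ y : F, ∑ a : Fin 6, (τ⁻¹ ^ (a : ℕ)) y * (η y * ψ (z * y)) := by
    have h0 : ∑ x : Fˣ, η ((x : F) ^ 6) * ψ (z * (x : F) ^ 6) =
        ∑ x : F, η (x ^ 6) * ψ (z * x ^ 6) := by
      rw [sum_units (fun x : F => η (x ^ 6) * ψ (z * x ^ 6))]; simp [MulChar.map_zero]
    rw [h0]
    have h1 : ∑ x : F, η (x ^ 6) * ψ (z * x ^ 6) =
        ∑ x : F, ∑ y : F, if x ^ 6 = y then η y * ψ (z * y) else 0 := by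
      refine Finset.sum_congr rfl fun x _ => ?_
      simp
    rw [h1, Finset.sum_comm]
    refine Finset.sum_congr rfl fun y _ => ?_
    by_cases hy : y = 0
    · subst hy; simp [MulChar.map_zero]
    · rw [← Finset.sum_mul, ← hcnt' y hy, ← Finset.sum_filter, Finset.sum_const, nsmul_eq_mul]
  rw [e1, Finset.sum_comm, Finset.mul_sum]
  refine Finset.sum_congr rfl fun a _ => ?_
  have h := gs_shift (η * τ⁻¹ ^ (a : ℕ)) ψ z z.ne_zero
  have h2 : ∑ y : F, (τ⁻¹ ^ (a : ℕ)) y * (η y * ψ (z * y)) =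
      ∑ x : F, (η * τ⁻¹ ^ (a : ℕ)) x * ψ (z * x) := by
    refine Finset.sum_congr rfl fun y _ => ?_
    rw [MulChar.mul_apply]; ring
  rw [h2, h]
  have h3 : η z * (η * τ⁻¹ ^ (a : ℕ))⁻¹ z = τ z ^ (a : ℕ) := by
    rw [← MulChar.mul_apply, inv_pow, mul_inv, inv_inv, mul_inv_cancel_left,
      MulChar.pow_apply_coe]
  rw [← mul_assoc, h3]; ring

end affine

section affine2

lemma addChar_sum {F : Type} [Field F] (ψ : AddChar F ℂ) {ι : Type} (s : Finset ι) (f : ι → F) :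
    ψ (∑ i ∈ s, f i) = ∏ i ∈ s, ψ (f i) := by
  induction s using Finset.cons_induction with
  | empty => simp
  | cons a s ha ih => rw [Finset.sum_cons, Finset.prod_cons, AddChar.map_add_eq_mul, ih]

variable {F : Type} [Field F] [Fintype F]

lemma orth_count {ψ : AddChar F ℂ} (hψ : ψ ≠ 1) {ι : Type} [Fintype ι] (e : ι → F) :
    (Fintype.card F : ℂ) * ∑ v : ι, (if e v = 0 then (1 : ℂ) else 0) =
      Fintype.card ι + ∑ z : Fˣ, ∑ v : ι, ψ (z * e v) := by
  rw [Finset.sum_comm, Finset.mul_sum, Fintype.card_eq_sum_ones (α := ι)]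
  push_cast
  rw [← Finset.sum_add_distrib]
  refine Finset.sum_congr rfl fun v _ => ?_
  have h := sum_add_shift hψ (e v)
  rw [sum_units (fun x : F => ψ (e v * x))] at h
  simp only [mul_zero, AddChar.map_zero_eq_one] at h
  simp_rw [mul_comm (_ : F) (e v)]
  rw [h]
  simp

lemma inner_eta (ψ : AddChar F ℂ) (c : Fˣ) :
    ∑ χ : MulChar F ℂ, gaussSum (χ ^ 6) ψ * χ⁻¹ ((c : F) ^ 6) =
      ((Fintype.card F : ℂ) - 1) *
        ∑ ζ ∈ Finset.univ.filter (fun ζ : Fˣ => ζ ^ 6 = 1), ψ (ζ * c) := by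
  have e1 : ∀ χ : MulChar F ℂ, gaussSum (χ ^ 6) ψ = ∑ ζ : Fˣ, (χ ^ 6) (ζ * c : F) * ψ (ζ * c) := by
    intro χ
    rw [gaussSum, sum_units (fun x : F => (χ ^ 6) x * ψ x), MulChar.map_zero, zero_mul, zero_add]
    symm
    refine Fintype.sum_equiv (Equiv.mulRight c) _ _ fun ζ => ?_
    simp
  simp_rw [e1, Finset.sum_mul]
  rw [Finset.sum_comm, Finset.sum_filter, Finset.mul_sum]
  refine Finset.sum_congr rfl fun ζ _ => ?_
  have e2 : ∀ χ : MulChar F ℂ, (χ ^ 6) (ζ * c : F) * ψ (ζ * c) * χ⁻¹ ((c : F) ^ 6) =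
      ψ (ζ * c) * χ ((ζ : F) ^ 6) := by
    intro χ
    have : χ ((c : F) ^ 6) * χ⁻¹ ((c : F) ^ 6) = 1 := by
      rw [← MulChar.mul_apply, mul_inv_cancel, MulChar.one_apply]
      exact (c.isUnit).pow 6
    rw [MulChar.pow_apply' _ (by norm_num), ← map_pow, mul_pow, map_mul]
    linear_combination (χ ((ζ : F) ^ 6)) * ψ (ζ * c) * this
  simp_rw [e2]
  rw [← Finset.mul_sum, sum_char _ (pow_ne_zero 6 ζ.ne_zero)]
  have : ((ζ : F) ^ 6 = 1) ↔ ζ ^ 6 = 1 := by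
    rw [← Units.val_pow_eq_pow_val, Units.val_eq_one]
  simp only [this]
  split_ifs <;> ring

variable {τ : MulChar F ℂ} (hord : orderOf τ = 6)
  (hcnt : ∀ u : F, u ≠ 0 → ((Finset.univ.filter (fun x : F => x ^ 6 = u)).card : ℂ) =
    ∑ a : Fin 6, (τ ^ (a : ℕ)) u)

include hcnt in
lemma card_mu6 : ((Finset.univ.filter (fun ζ : Fˣ => ζ ^ 6 = 1)).card : ℂ) = 6 := by
  have h := hcnt 1 one_ne_zero
  simp only [map_one, Finset.sum_const, Finset.card_univ, Fintype.card_fin, nsmul_eq_mul,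
    mul_one] at h
  have h2 : (Finset.univ.filter (fun ζ : Fˣ => ζ ^ 6 = 1)).card =
      (Finset.univ.filter (fun x : F => x ^ 6 = 1)).card := by
    refine Finset.card_bij (fun u _ => (u : F)) ?_ ?_ ?_
    · intro u hu
      simp only [Finset.mem_filter, Finset.mem_univ, true_and] at hu ⊢
      rw [← Units.val_pow_eq_pow_val, hu, Units.val_one]
    · intro a _ b _ hab; exact Units.ext hab
    · intro b hb
      simp only [Finset.mem_filter, Finset.mem_univ, true_and] at hb
      have hb0 : b ≠ 0 := by rintro rfl; norm_num at hb
      refine ⟨Units.mk0 b hb0, ?_, rfl⟩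
      simp only [Finset.mem_filter, Finset.mem_univ, true_and]
      apply Units.ext
      simpa using hb
  rw [h2, h]; norm_num

include hord hcnt in
lemma W_eq (ψ : AddChar F ℂ) (μ : Fˣ) :
    6 * ∑ z : Fˣ, ∑ v : Fin 6 → Fˣ, ψ (z * (∑ i, (v i : F) ^ 6 - μ * ∏ i, (v i : F))) =
      ∑ χ : MulChar F ℂ, gaussSum (χ ^ 6) ψ * χ⁻¹ ((μ : F) ^ 6) *
        P6 (fun a => gaussSum (χ⁻¹ * (τ⁻¹) ^ (a : ℕ)) ψ) := by
  have hq1 : (Fintype.card F : ℂ) - 1 ≠ 0 := card_sub_one_ne_zero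
  rw [← mul_right_inj' hq1]
  symm
  have st1 : ∀ χ : MulChar F ℂ, ((Fintype.card F : ℂ) - 1) *
      P6 (fun a => gaussSum (χ⁻¹ * (τ⁻¹) ^ (a : ℕ)) ψ) =
      ∑ z : Fˣ, ∑ v : Fin 6 → Fˣ, χ⁻¹ (((z : F) * ∏ i, (v i : F)) ^ 6) *
        ψ (z * ∑ i, (v i : F) ^ 6) := by
    intro χ
    rw [← sum_units_pow6 hord]
    refine Finset.sum_congr rfl fun z _ => ?_
    rw [← sixth_sum hord hcnt ψ χ⁻¹ z, mul_pow, Fintype.sum_pow, Finset.mul_sum]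
    refine Finset.sum_congr rfl fun v _ => ?_
    rw [Finset.prod_mul_distrib, ← map_prod, Finset.mul_sum, addChar_sum, ← mul_assoc]
    congr 1
    rw [← map_pow, ← map_mul, Finset.prod_pow, mul_pow]
  have st2 : ∀ χ : MulChar F ℂ, ((Fintype.card F : ℂ) - 1) * (gaussSum (χ ^ 6) ψ *
      χ⁻¹ ((μ : F) ^ 6) * P6 (fun a => gaussSum (χ⁻¹ * (τ⁻¹) ^ (a : ℕ)) ψ)) =
      ∑ z : Fˣ, ∑ v : Fin 6 → Fˣ, (gaussSum (χ ^ 6) ψ *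
        χ⁻¹ (((-(μ * z * ∏ i, v i) : Fˣ) : F) ^ 6)) * ψ (z * ∑ i, (v i : F) ^ 6) := by
    intro χ
    rw [mul_left_comm, st1, Finset.mul_sum]
    refine Finset.sum_congr rfl fun z _ => ?_
    rw [Finset.mul_sum]
    refine Finset.sum_congr rfl fun v _ => ?_
    rw [← mul_assoc, mul_assoc (gaussSum _ _), ← map_mul]
    congr 3
    push_cast
    ring
  rw [Finset.mul_sum]
  simp_rw [st2]
  rw [Finset.sum_comm]
  have st3 : ∀ z : Fˣ, ∑ χ : MulChar F ℂ, ∑ v : Fin 6 → Fˣ, (gaussSum (χ ^ 6) ψ *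
        χ⁻¹ (((-(μ * z * ∏ i, v i) : Fˣ) : F) ^ 6)) * ψ (z * ∑ i, (v i : F) ^ 6) =
      ((Fintype.card F : ℂ) - 1) * (6 * ∑ v : Fin 6 → Fˣ,
        ψ (z * (∑ i, (v i : F) ^ 6 - μ * ∏ i, (v i : F)))) := by
    intro z
    rw [Finset.sum_comm]
    simp_rw [← Finset.sum_mul, inner_eta, mul_assoc, ← Finset.mul_sum]
    congr 1
    simp_rw [Finset.sum_mul]
    rw [Finset.sum_comm, ← card_mu6 hcnt, ← nsmul_eq_mul, ← Finset.sum_const]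
    refine Finset.sum_congr rfl fun ζ hζ => ?_
    simp only [Finset.mem_filter, Finset.mem_univ, true_and] at hζ
    refine Fintype.sum_equiv (Equiv.mulLeft (Pi.mulSingle (0 : Fin 6) ζ)) _ _ fun v => ?_
    rw [← AddChar.map_add_eq_mul]
    congr 1
    have hζ' : (ζ : F) ^ 6 = 1 := by rw [← Units.val_pow_eq_pow_val, hζ, Units.val_one]
    have e0 : ∀ j : Fin 6, j ≠ 0 → Pi.mulSingle (M := fun _ => Fˣ) (0 : Fin 6) ζ j = 1 :=
      fun j hj => Pi.mulSingle_eq_of_ne hj _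
    simp only [Equiv.coe_mulLeft, Pi.mul_apply, Fin.sum_univ_six, Fin.prod_univ_six,
      Pi.mulSingle_eq_same, e0 1 (by decide), e0 2 (by decide), e0 3 (by decide),
      e0 4 (by decide), e0 5 (by decide)]
    push_cast
    linear_combination (-(z : F) * (v 0 : F) ^ 6) * hζ'
  rw [Finset.sum_congr rfl fun z _ => st3 z, ← Finset.mul_sum, ← Finset.mul_sum]

include hord hcnt in
lemma affine_count {ψ : AddChar F ℂ} (hψ : ψ ≠ 1) (μ : F) (hμ : μ ≠ 0) :
    6 * (Fintype.card F : ℂ) * ((Finset.univ.filter (fun v : Fin 6 → F =>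
        ∑ i, v i ^ 6 = μ * ∏ i, v i)).card : ℂ) =
      6 * (Fintype.card F : ℂ) ^ 6 + 6 * ((Fintype.card F : ℂ) - 1) *
        (P6 (Function.update (fun a : Fin 6 => gaussSum ((τ⁻¹) ^ (a : ℕ)) ψ) 0 0) -
          P6 (fun a : Fin 6 => gaussSum ((τ⁻¹) ^ (a : ℕ)) ψ)) +
      ∑ χ : MulChar F ℂ, gaussSum (χ ^ 6) ψ * χ⁻¹ (μ ^ 6) *
        P6 (fun a => gaussSum (χ⁻¹ * (τ⁻¹) ^ (a : ℕ)) ψ) := by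
  have W := W_eq hord hcnt ψ (Units.mk0 μ hμ)
  rw [Units.val_mk0] at W
  rw [← W]
  have A := sum_all_units (fun v : Fin 6 → F => if ∑ i, v i ^ 6 - μ * ∏ i, v i = 0 then (1 : ℂ) else 0)
    (fun v : Fin 6 → F => if ∑ i, v i ^ 6 = 0 then (1 : ℂ) else 0) (by
      rintro v ⟨i, hi⟩
      rw [Finset.prod_eq_zero (Finset.mem_univ i) hi, mul_zero, sub_zero])
  have cA : ((Finset.univ.filter (fun v : Fin 6 → F => ∑ i, v i ^ 6 = μ * ∏ i, v i)).card : ℂ) =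
      ∑ v : Fin 6 → F, if ∑ i, v i ^ 6 - μ * ∏ i, v i = 0 then (1 : ℂ) else 0 := by
    rw [Finset.card_filter]
    push_cast
    simp_rw [sub_eq_zero]
  have c1 := orth_count hψ (fun v : Fin 6 → Fˣ => ∑ i, (v i : F) ^ 6 - μ * ∏ i, (v i : F))
  have c2 := orth_count hψ (fun v : Fin 6 → Fˣ => ∑ i, (v i : F) ^ 6)
  have c3 := orth_count hψ (fun v : Fin 6 → F => ∑ i, (v i : F) ^ 6)
  have hs : ∀ z : Fˣ, ∑ x : Fˣ, ψ (z * (x : F) ^ 6) =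
      ∑ a : Fin 6, gaussSum ((τ⁻¹) ^ (a : ℕ)) ψ * (τ (z : F)) ^ (a : ℕ) := by
    intro z
    have h := sixth_sum hord hcnt ψ 1 z
    simp only [one_mul, ← Units.val_pow_eq_pow_val, MulChar.one_apply_coe] at h
    simpa using h
  have hs2 : ∀ z : Fˣ, ∑ x : F, ψ (z * x ^ 6) =
      ∑ a : Fin 6, (Function.update (fun a : Fin 6 => gaussSum ((τ⁻¹) ^ (a : ℕ)) ψ) 0 0) a *
        (τ (z : F)) ^ (a : ℕ) := by
    intro z
    rw [sum_units (fun x : F => ψ (z * x ^ 6)), hs]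
    simp only [Fin.sum_univ_succ]
    simp [gaussSum_one_left hψ, Function.update]
  have p2 : ∑ z : Fˣ, ∑ v : Fin 6 → Fˣ, ψ (z * ∑ i, (v i : F) ^ 6) =
      ((Fintype.card F : ℂ) - 1) * P6 (fun a : Fin 6 => gaussSum ((τ⁻¹) ^ (a : ℕ)) ψ) := by
    rw [← sum_units_pow6 hord]
    refine Finset.sum_congr rfl fun z _ => ?_
    rw [← hs z, Fintype.sum_pow]
    refine Finset.sum_congr rfl fun v _ => ?_
    rw [Finset.mul_sum, addChar_sum]
  have p3 : ∑ z : Fˣ, ∑ v : Fin 6 → F, ψ (z * ∑ i, (v i : F) ^ 6) =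
      ((Fintype.card F : ℂ) - 1) *
        P6 (Function.update (fun a : Fin 6 => gaussSum ((τ⁻¹) ^ (a : ℕ)) ψ) 0 0) := by
    rw [← sum_units_pow6 hord]
    refine Finset.sum_congr rfl fun z _ => ?_
    rw [← hs2 z, Fintype.sum_pow]
    refine Finset.sum_congr rfl fun v _ => ?_
    rw [Finset.mul_sum, addChar_sum]
  rw [p2] at c2
  rw [p3] at c3
  have k3 : (Fintype.card (Fin 6 → F) : ℂ) = (Fintype.card F : ℂ) ^ 6 := by
    simp
  rw [k3] at c3
  rw [cA]
  linear_combination 6 * (Fintype.card F : ℂ) * A + 6 * c1 - 6 * c2 + 6 * c3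

end affine2

section reps

/-- Exponents of the orbit representatives. -/
def nn : Fin 14 → Fin 6 → ℕ :=
  ![![6, 0, 0, 0, 0, 0], ![4, 1, 0, 0, 0, 1], ![4, 0, 1, 0, 1, 0], ![4, 0, 0, 2, 0, 0],
    ![3, 0, 3, 0, 0, 0], ![3, 0, 1, 0, 0, 2], ![3, 2, 0, 0, 1, 0], ![2, 2, 2, 0, 0, 0],
    ![2, 0, 2, 0, 2, 0], ![3, 0, 0, 1, 1, 1], ![3, 1, 1, 1, 0, 0], ![2, 1, 0, 2, 0, 1],
    ![2, 1, 0, 1, 2, 0], ![2, 1, 1, 0, 1, 1]]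

/-- Multiplicities of the orbit representatives. -/
noncomputable def cc : Fin 14 → ℂ :=
  ![1, 30, 30, 15, 20, 60, 60, 90, 30, 120, 120, 180, 180, 360]

/-- The sum over orbit representatives. -/
noncomputable def Q6 (h : Fin 6 → ℂ) : ℂ := ∑ k, cc k * ∏ b, h b ^ nn k b

/-- Explicit form of `P6`. -/
lemma P6_explicit (h : Fin 6 → ℂ) : P6 h =
    (fun c : Fin 6 → ℂ => c 0 * c 0 + 2 * c 1 * c 5 + 2 * c 2 * c 4 + c 3 * c 3)
      (conv6 (conv6 h h) h) := by
  simp only [P6]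
  generalize conv6 (conv6 h h) h = c
  simp only [conv6, Fin.sum_univ_six, show (0 : Fin 6) - 0 = 0 from rfl,
    show (0 : Fin 6) - 1 = 5 from rfl, show (0 : Fin 6) - 2 = 4 from rfl,
    show (0 : Fin 6) - 3 = 3 from rfl, show (0 : Fin 6) - 4 = 2 from rfl,
    show (0 : Fin 6) - 5 = 1 from rfl]
  ring

lemma conv6_explicit (c k : Fin 6 → ℂ) : conv6 c k =
    ![c 0 * k 0 + c 1 * k 5 + c 2 * k 4 + c 3 * k 3 + c 4 * k 2 + c 5 * k 1,
      c 0 * k 1 + c 1 * k 0 + c 2 * k 5 + c 3 * k 4 + c 4 * k 3 + c 5 * k 2,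
      c 0 * k 2 + c 1 * k 1 + c 2 * k 0 + c 3 * k 5 + c 4 * k 4 + c 5 * k 3,
      c 0 * k 3 + c 1 * k 2 + c 2 * k 1 + c 3 * k 0 + c 4 * k 5 + c 5 * k 4,
      c 0 * k 4 + c 1 * k 3 + c 2 * k 2 + c 3 * k 1 + c 4 * k 0 + c 5 * k 5,
      c 0 * k 5 + c 1 * k 4 + c 2 * k 3 + c 3 * k 2 + c 4 * k 1 + c 5 * k 0] := by
  funext r
  rw [conv6, Fin.sum_univ_six]
  fin_cases r <;> rfl

/-- `Q6` as an explicit polynomial. -/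
lemma Q6_poly (h : Fin 6 → ℂ) : Q6 h =
    h 0 ^ 6 + 30 * h 0 ^ 4 * h 1 * h 5 + 30 * h 0 ^ 4 * h 2 * h 4 + 15 * h 0 ^ 4 * h 3 ^ 2 +
      20 * h 0 ^ 3 * h 2 ^ 3 + 60 * h 0 ^ 3 * h 2 * h 5 ^ 2 + 60 * h 0 ^ 3 * h 1 ^ 2 * h 4 +
      90 * h 0 ^ 2 * h 1 ^ 2 * h 2 ^ 2 + 30 * h 0 ^ 2 * h 2 ^ 2 * h 4 ^ 2 +
      120 * h 0 ^ 3 * h 3 * h 4 * h 5 + 120 * h 0 ^ 3 * h 1 * h 2 * h 3 +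
      180 * h 0 ^ 2 * h 1 * h 3 ^ 2 * h 5 + 180 * h 0 ^ 2 * h 1 * h 3 * h 4 ^ 2 +
      360 * h 0 ^ 2 * h 1 * h 2 * h 4 * h 5 := by
  simp only [Q6, Fin.sum_univ_succ, Fin.prod_univ_succ]
  simp [cc, nn]
  ring

set_option maxRecDepth 10000 in
lemma P6_eq (h : Fin 6 → ℂ) : P6 h = ∑ k, Q6 (fun a => h (a + k)) := by
  simp only [Q6_poly]
  rw [Fin.sum_univ_six, P6_explicit, conv6_explicit, conv6_explicit]
  simp only [Matrix.cons_val, Fin.reduceAdd, add_zero, zero_add]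
  ring

set_option maxRecDepth 10000 in
lemma K_eq (h : Fin 6 → ℂ) : P6 h - P6 (Function.update h 0 0) =
    ∑ k, cc k * ∑ a, if nn k a = 0 then 0 else ∏ b, h (b - a) ^ nn k b := by
  have hu : Function.update h 0 0 = ![0, h 1, h 2, h 3, h 4, h 5] := by
    funext i; fin_cases i <;> rfl
  rw [P6_eq, P6_eq, hu]
  simp only [Q6_poly, Fin.sum_univ_six]
  simp only [Matrix.cons_val, Fin.reduceAdd, add_zero, zero_add]
  simp only [Fin.sum_univ_succ, Fin.prod_univ_succ]
  simp [cc, nn]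
  simp only [show (-1 : Fin 6) = 5 from rfl, show (-2 : Fin 6) = 4 from rfl,
    show (-3 : Fin 6) = 3 from rfl, show (-4 : Fin 6) = 2 from rfl,
    show (-5 : Fin 6) = 1 from rfl]
  ring

end reps

section corr

variable {F : Type} [Field F] [Fintype F]

lemma tau_fin_add {τ : MulChar F ℂ} (hord : orderOf τ = 6) (a b : Fin 6) :
    τ ^ ((a + b : Fin 6) : ℕ) = τ ^ (a : ℕ) * τ ^ (b : ℕ) := by
  have hz : τ ^ 6 = 1 := by rw [← hord, pow_orderOf_eq_one]
  rw [Fin.val_add, ← pow_add]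
  conv_rhs => rw [← Nat.mod_add_div ((a : ℕ) + b) 6]
  rw [pow_add, pow_mul, hz, one_pow, mul_one]

lemma tau_fin_inj {τ : MulChar F ℂ} (hord : orderOf τ = 6) (a b : Fin 6)
    (h : τ ^ (a : ℕ) = τ ^ (b : ℕ)) : a = b := by
  apply Fin.ext
  refine pow_injOn_Iio_orderOf ?_ ?_ h
  · rw [hord]; exact a.2
  · rw [hord]; exact b.2

/-- The function `χ(x) ∏ g(χ τ^a)`. -/
noncomputable def ff (τ : MulChar F ℂ) (ψ : AddChar F ℂ) (x : F) (χ : MulChar F ℂ) : ℂ :=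
  χ x * ∏ a : Fin 6, gaussSum (χ * τ ^ (a : ℕ)) ψ

/-- The Gauss sums `g(χ⁻¹ τ⁻ᵃ)`. -/
noncomputable def HH (τ : MulChar F ℂ) (ψ : AddChar F ℂ) (χ : MulChar F ℂ) (a : Fin 6) : ℂ :=
  gaussSum (χ⁻¹ * τ⁻¹ ^ (a : ℕ)) ψ

/-- The idealised summand. -/
noncomputable def Ide (τ : MulChar F ℂ) (ψ : AddChar F ℂ) (x : F) (n : Fin 6 → ℕ)
    (χ : MulChar F ℂ) : ℂ :=
  χ x * ∏ a : Fin 6, if n a = 0 then gaussSum (χ * τ ^ (a : ℕ)) ψ else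
    (χ * τ ^ (a : ℕ)) (-1) * (Fintype.card F : ℂ) * HH τ ψ χ a ^ (n a - 1)

variable {τ : MulChar F ℂ} (hord : orderOf τ = 6) {ψ : AddChar F ℂ} (hψ : ψ ≠ 1)
  {x : F} (hx : τ x = 1)

include hord in
lemma HH_shift (χ : MulChar F ℂ) (a k : Fin 6) :
    HH τ ψ χ (a + k) = HH τ ψ (χ * τ ^ (k : ℕ)) a := by
  unfold HH
  congr 1
  rw [inv_pow, inv_pow, tau_fin_add hord, mul_inv, mul_inv, mul_assoc, mul_comm (τ ^ (a : ℕ))⁻¹]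

include hord hx in
lemma ff_shift (χ : MulChar F ℂ) (k : Fin 6) : ff τ ψ x (χ * τ ^ (k : ℕ)) = ff τ ψ x χ := by
  have hxu : IsUnit x := by
    by_contra h
    rw [MulChar.map_nonunit _ h] at hx
    exact zero_ne_one hx
  unfold ff
  congr 1
  · rw [MulChar.mul_apply, show (τ ^ (k : ℕ)) x = 1 by
      rw [← hxu.unit_spec, MulChar.pow_apply_coe, hxu.unit_spec, hx, one_pow], mul_one]
  · refine Fintype.prod_equiv (Equiv.addLeft k) _ _ fun a => ?_
    rw [Equiv.coe_addLeft, tau_fin_add hord, mul_assoc]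

include hord hx in
lemma sum_ff_P6 :
    ∑ χ : MulChar F ℂ, ff τ ψ x χ * P6 (HH τ ψ χ) =
      6 * ∑ χ : MulChar F ℂ, ff τ ψ x χ * Q6 (HH τ ψ χ) := by
  simp_rw [P6_eq, Finset.mul_sum (s := (Finset.univ : Finset (Fin 6)))]
  rw [Finset.sum_comm]
  have : ∀ k : Fin 6, ∑ χ : MulChar F ℂ, ff τ ψ x χ * Q6 (fun a => HH τ ψ χ (a + k)) =
      ∑ χ : MulChar F ℂ, ff τ ψ x χ * Q6 (HH τ ψ χ) := by
    intro k
    refine Fintype.sum_equiv (Equiv.mulRight (τ ^ (k : ℕ))) _ _ fun χ => ?_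
    simp only [Equiv.coe_mulRight]
    rw [ff_shift hord hx]
    congr 2
    funext a
    exact HH_shift hord χ a k
  simp_rw [this]
  simp

include hψ in
lemma factor (χ : MulChar F ℂ) (a : Fin 6) (m : ℕ) :
    (if m = 0 then gaussSum (χ * τ ^ (a : ℕ)) ψ else
    (χ * τ ^ (a : ℕ)) (-1) * (Fintype.card F : ℂ) * HH τ ψ χ a ^ (m - 1)) =
    gaussSum (χ * τ ^ (a : ℕ)) ψ * HH τ ψ χ a ^ m *
      (if m ≠ 0 ∧ χ * τ ^ (a : ℕ) = 1 then (Fintype.card F : ℂ) else 1) := by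
  have hH : HH τ ψ χ a = gaussSum (χ * τ ^ (a : ℕ))⁻¹ ψ := by
    unfold HH; rw [inv_pow, mul_inv]
  by_cases hm : m = 0
  · subst hm; simp
  obtain ⟨m, rfl⟩ := Nat.exists_eq_succ_of_ne_zero hm
  rw [hH, if_neg hm]
  by_cases hc : χ * τ ^ (a : ℕ) = 1
  · rw [if_pos ⟨hm, hc⟩, hc, inv_one, gaussSum_one_left hψ, Nat.succ_sub_one, pow_succ,
      MulChar.one_apply (by simp)]
    ring
  · rw [if_neg (fun h => hc h.2), ← gs_mul_inv hψ hc, Nat.succ_sub_one, pow_succ]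
    ring

lemma prod_ite_one (s : Finset (Fin 6)) (p : Fin 6 → Prop) [DecidablePred p] (q : ℂ)
    (hp : ∀ a b, p a → p b → a = b) :
    ∏ a ∈ s, (if p a then q else 1) = 1 + ∑ a ∈ s, if p a then q - 1 else 0 := by
  by_cases h : ∃ a ∈ s, p a
  · obtain ⟨a, ha, hpa⟩ := h
    rw [Finset.prod_eq_single_of_mem a ha, Finset.sum_eq_single_of_mem a ha, if_pos hpa, if_pos hpa]
    · ring
    · intro b _ hb; exact if_neg fun h => hb (hp _ _ h hpa)
    · intro b _ hb; exact if_neg fun h => hb (hp _ _ h hpa)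
  · push Not at h
    rw [Finset.prod_eq_one fun a ha => if_neg (h a ha),
      Finset.sum_eq_zero fun a ha => if_neg (h a ha), add_zero]

include hord hψ in
lemma Ide_eq (n : Fin 6 → ℕ) (χ : MulChar F ℂ) :
    Ide τ ψ x n χ = ff τ ψ x χ * ∏ b, HH τ ψ χ b ^ n b +
      ∑ a, if n a ≠ 0 ∧ χ * τ ^ (a : ℕ) = 1 then
        ((Fintype.card F : ℂ) - 1) * (ff τ ψ x χ * ∏ b, HH τ ψ χ b ^ n b) else 0 := by
  unfold Ide
  simp_rw [factor hψ χ]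
  rw [Finset.prod_mul_distrib, Finset.prod_mul_distrib, prod_ite_one Finset.univ (fun a => n a ≠ 0 ∧ χ * τ ^ (a : ℕ) = 1)]
  · have e : ∀ a, (if n a ≠ 0 ∧ χ * τ ^ (a : ℕ) = 1 then
        ((Fintype.card F : ℂ) - 1) * (ff τ ψ x χ * ∏ b, HH τ ψ χ b ^ n b) else 0) =
        (ff τ ψ x χ * ∏ b, HH τ ψ χ b ^ n b) *
        (if n a ≠ 0 ∧ χ * τ ^ (a : ℕ) = 1 then (Fintype.card F : ℂ) - 1 else 0) := by
      intro a; split_ifs <;> ring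
    simp_rw [e]
    rw [← Finset.mul_sum]
    unfold ff
    ring
  · rintro a b ⟨_, ha⟩ ⟨_, hb⟩
    exact tau_fin_inj hord a b (mul_left_cancel (ha.trans hb.symm))

include hord hψ in
lemma sum_Ide (n : Fin 6 → ℕ) :
    ∑ χ : MulChar F ℂ, Ide τ ψ x n χ = ∑ χ : MulChar F ℂ, ff τ ψ x χ * ∏ b, HH τ ψ χ b ^ n b +
      ((Fintype.card F : ℂ) - 1) * ∑ a, if n a = 0 then 0 else
        ff τ ψ x (τ ^ (a : ℕ))⁻¹ * ∏ b, HH τ ψ (τ ^ (a : ℕ))⁻¹ b ^ n b := by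
  simp_rw [Ide_eq hord hψ]
  rw [Finset.sum_add_distrib]
  congr 1
  rw [Finset.sum_comm, Finset.mul_sum]
  refine Finset.sum_congr rfl fun a _ => ?_
  by_cases hn : n a = 0
  · simp [hn]
  · rw [if_neg hn]
    have : ∀ χ : MulChar F ℂ, (n a ≠ 0 ∧ χ * τ ^ (a : ℕ) = 1) ↔ χ = (τ ^ (a : ℕ))⁻¹ := by
      intro χ
      rw [mul_eq_one_iff_eq_inv]
      exact ⟨fun h => h.2, fun h => ⟨hn, h⟩⟩
    simp_rw [this]
    simp

include hord hψ in
lemma gs_tau_vals : gaussSum (τ ^ 3) ψ ^ 2 = τ (-1) * Fintype.card F ∧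
    gaussSum τ ψ * gaussSum (τ ^ 5) ψ = τ (-1) * Fintype.card F ∧
    gaussSum (τ ^ 2) ψ * gaussSum (τ ^ 4) ψ = Fintype.card F ∧ τ (-1) ^ 2 = 1 := by
  have h6 : τ ^ 6 = 1 := by rw [← hord, pow_orderOf_eq_one]
  have hne : ∀ k : ℕ, 0 < k → k < 6 → τ ^ k ≠ 1 := by
    intro k hk hk6 h
    have := Nat.le_of_dvd hk (orderOf_dvd_of_pow_eq_one h)
    omega
  have hs : τ (-1) ^ 2 = 1 := by rw [← map_pow]; simp
  have i1 : (τ ^ 1)⁻¹ = τ ^ 5 := by rw [inv_eq_iff_mul_eq_one, ← pow_add, h6]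
  have i2 : (τ ^ 2)⁻¹ = τ ^ 4 := by rw [inv_eq_iff_mul_eq_one, ← pow_add, h6]
  have i3 : (τ ^ 3)⁻¹ = τ ^ 3 := by rw [inv_eq_iff_mul_eq_one, ← pow_add, h6]
  have g1 := gs_mul_inv hψ (hne 1 (by norm_num) (by norm_num))
  have g2 := gs_mul_inv hψ (hne 2 (by norm_num) (by norm_num))
  have g3 := gs_mul_inv hψ (hne 3 (by norm_num) (by norm_num))
  rw [i1, pow_one] at g1
  rw [i2, MulChar.pow_apply' _ (by norm_num), hs, one_mul] at g2
  rw [i3, MulChar.pow_apply' _ (by norm_num), show τ (-1) ^ 3 = τ (-1) by rw [pow_succ, hs, one_mul]] at g3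
  exact ⟨by rw [sq]; exact g3, g1, g2, hs⟩

include hord hψ hx in
lemma ff_tau (a : Fin 6) : gaussSum (τ ^ 3) ψ * ff τ ψ x (τ ^ (a : ℕ))⁻¹ =
    - (Fintype.card F : ℂ) ^ 3 := by
  have h1 : ff τ ψ x (τ ^ (a : ℕ))⁻¹ = ff τ ψ x 1 := by
    rw [← ff_shift hord hx (τ ^ (a : ℕ))⁻¹ a, inv_mul_cancel]
  have hxu : IsUnit x := by
    by_contra h
    rw [MulChar.map_nonunit _ h] at hx
    exact zero_ne_one hx
  obtain ⟨v3, v1, v2, hs⟩ := gs_tau_vals hord hψ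
  rw [h1, ff, MulChar.one_apply hxu, Fin.prod_univ_six]
  simp only [one_mul, Fin.coe_ofNat_eq_mod, Nat.zero_mod, pow_zero, gaussSum_one_left hψ]
  norm_num
  generalize gaussSum (τ ^ 3) ψ = g3 at *
  generalize gaussSum (τ ^ 2) ψ = g2 at *
  generalize gaussSum (τ ^ 4) ψ = g4 at *
  generalize gaussSum (τ ^ 5) ψ = g5 at *
  generalize gaussSum τ ψ = g1 at *
  calc g3 * (g1 * g2 * g3 * g4 * g5) = g3 ^ 2 * (g1 * g5) * (g2 * g4) := by ring
    _ = τ (-1) ^ 2 * (Fintype.card F : ℂ) ^ 3 := by rw [v3, v1, v2]; ring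
    _ = _ := by rw [hs, one_mul]

include hord hψ hx in
lemma sum_ff_Q6 :
    gaussSum (τ ^ 3) ψ * ∑ χ : MulChar F ℂ, ff τ ψ x χ * Q6 (HH τ ψ χ) =
      ∑ k, cc k * (gaussSum (τ ^ 3) ψ * ∑ χ : MulChar F ℂ, Ide τ ψ x (nn k) χ) +
      ((Fintype.card F : ℂ) - 1) * (Fintype.card F : ℂ) ^ 3 *
        (P6 (HH τ ψ 1) - P6 (Function.update (HH τ ψ 1) 0 0)) := by
  rw [K_eq]
  simp_rw [sum_Ide hord hψ]
  have e1 : ∑ χ : MulChar F ℂ, ff τ ψ x χ * Q6 (HH τ ψ χ) =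
      ∑ k, cc k * ∑ χ : MulChar F ℂ, ff τ ψ x χ * ∏ b, HH τ ψ χ b ^ nn k b := by
    simp_rw [Q6, Finset.mul_sum]
    rw [Finset.sum_comm]
    refine Finset.sum_congr rfl fun k _ => Finset.sum_congr rfl fun χ _ => ?_
    ring
  have e2 : ∀ k, gaussSum (τ ^ 3) ψ * (∑ a, if nn k a = 0 then 0 else
        ff τ ψ x (τ ^ (a : ℕ))⁻¹ * ∏ b, HH τ ψ (τ ^ (a : ℕ))⁻¹ b ^ nn k b) =
      - (Fintype.card F : ℂ) ^ 3 *
        ∑ a, if nn k a = 0 then 0 else ∏ b, HH τ ψ 1 (b - a) ^ nn k b := by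
    intro k
    rw [Finset.mul_sum, Finset.mul_sum]
    refine Finset.sum_congr rfl fun a _ => ?_
    split_ifs
    · simp
    · rw [← mul_assoc, ff_tau hord hψ hx]
      congr 1
      refine Finset.prod_congr rfl fun b _ => ?_
      rw [show HH τ ψ (τ ^ (a : ℕ))⁻¹ b = HH τ ψ 1 (b - a) by
        conv_lhs => rw [← sub_add_cancel b a, HH_shift hord, inv_mul_cancel]]
  rw [e1, Finset.mul_sum, Finset.mul_sum, ← Finset.sum_add_distrib]
  refine Finset.sum_congr rfl fun k _ => ?_
  rw [mul_add, mul_left_comm _ ((Fintype.card F : ℂ) - 1), e2]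
  ring

end corr

section comb

variable {F : Type} [Field F] [Fintype F]

theorem main_ide (ω : MulChar F ℂ) (hω : ∀ χ : MulChar F ℂ, ∃ j : ℕ, χ = ω ^ j) (t : ℕ)
    (ht : 6 * t = Fintype.card F - 1) (h2 : (2 : F) ≠ 0) (h3 : (3 : F) ≠ 0)
    {ψ : AddChar F ℂ} (hψ : ψ ≠ 1) (lam : F) (hlam : lam ≠ 0) :
    (Fintype.card F : ℂ) ^ 4 * ((Fintype.card F : ℂ) - 1) * (dworkCount F 6 lam : ℂ) =
      (Fintype.card F : ℂ) ^ 9 - (Fintype.card F : ℂ) ^ 4 +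
      ∑ k, cc k * (gaussSum ((ω ^ t) ^ 3) ψ *
        ∑ χ : MulChar F ℂ, Ide (ω ^ t) ψ (lam ^ 6)⁻¹ (nn k) χ) := by
  have hord : orderOf (ω ^ t) = 6 := orderOf_gen_pow ω hω 6 t ht
  have hcnt : ∀ u : F, u ≠ 0 → ((Finset.univ.filter fun x : F => x ^ 6 = u).card : ℂ) =
      ∑ a : Fin 6, ((ω ^ t) ^ (a : ℕ)) u := by
    intro u hu
    rw [count_pow ω hω 6 t (by norm_num) ht u hu, Finset.sum_range]
  have h6 : (6 : F) ≠ 0 := by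
    rw [show (6 : F) = 2 * 3 by norm_num]; exact mul_ne_zero h2 h3
  have hmu : (6 * lam : F) ≠ 0 := mul_ne_zero h6 hlam
  have hq : (Fintype.card F : ℂ) ≠ 0 := card_ne_zero'
  have hx : (ω ^ t) (lam ^ 6)⁻¹ = 1 := by
    rw [← inv_pow, map_pow, ← MulChar.pow_apply' _ (by norm_num), ← hord, pow_orderOf_eq_one,
      MulChar.one_apply (IsUnit.mk0 _ (inv_ne_zero hlam))]
  obtain ⟨v3, v1, v2, hs⟩ := gs_tau_vals hord hψ
  have A := affine_count hord hcnt hψ (6 * lam) hmu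
  have B := dwork_affine lam
  have C := sum_ff_P6 (ψ := ψ) hord hx
  have D := sum_ff_Q6 hord hψ hx
  have key : ∀ χ : MulChar F ℂ, (Fintype.card F : ℂ) ^ 3 *
      (gaussSum (χ ^ 6) ψ * χ⁻¹ ((6 * lam) ^ 6)) =
      gaussSum ((ω ^ t) ^ 3) ψ * ff (ω ^ t) ψ (lam ^ 6)⁻¹ χ := by
    intro χ
    have G := gauss_six ω hω t ht h2 h3 hψ χ
    have e1 : χ⁻¹ ((6 * lam) ^ 6) * (χ ^ 6) 6 = χ (lam ^ 6)⁻¹ := by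
      rw [MulChar.inv_apply', MulChar.pow_apply' _ (by norm_num), ← map_pow, ← map_mul]
      congr 1
      field_simp
    have e2 : (χ ^ 6) 6 ≠ 0 := by
      rw [MulChar.pow_apply' _ (by norm_num)]
      refine pow_ne_zero _ ?_
      exact ((IsUnit.mk0 _ h6).map χ).ne_zero
    have e3 : gaussSum ((ω ^ t) ^ 3) ψ ^ 4 = (Fintype.card F : ℂ) ^ 2 := by
      rw [show 4 = 2 * 2 from rfl, pow_mul, v3, mul_pow, hs, one_mul]
    have eff : ff (ω ^ t) ψ (lam ^ 6)⁻¹ χ = χ (lam ^ 6)⁻¹ * (gaussSum χ ψ * gaussSum (χ * ω ^ t) ψ *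
        gaussSum (χ * (ω ^ t) ^ 2) ψ * gaussSum (χ * (ω ^ t) ^ 3) ψ *
        gaussSum (χ * (ω ^ t) ^ 4) ψ * gaussSum (χ * (ω ^ t) ^ 5) ψ) := by
      rw [ff, Fin.prod_univ_six]
      congr 1
      simp [show ((2 : Fin 6) : ℕ) = 2 from rfl, show ((3 : Fin 6) : ℕ) = 3 from rfl,
        show ((4 : Fin 6) : ℕ) = 4 from rfl, show ((5 : Fin 6) : ℕ) = 5 from rfl]
    apply mul_right_cancel₀ e2
    rw [eff]
    rw [← e1]
    linear_combination (-(gaussSum ((ω ^ t) ^ 3) ψ * χ⁻¹ ((6 * lam) ^ 6) * (χ ^ 6) 6)) * G - (Fintype.card F : ℂ) * gaussSum (χ ^ 6) ψ * χ⁻¹ ((6 * lam) ^ 6) * (χ ^ 6) 6 * e3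
  have hH : (HH (ω ^ t) ψ 1) = fun a : Fin 6 => gaussSum ((ω ^ t)⁻¹ ^ (a : ℕ)) ψ := by
    funext a; rw [HH, inv_one, one_mul]
  have S : (Fintype.card F : ℂ) ^ 3 * ∑ χ : MulChar F ℂ, gaussSum (χ ^ 6) ψ * χ⁻¹ ((6 * lam) ^ 6) *
      P6 (fun a : Fin 6 => gaussSum (χ⁻¹ * (ω ^ t)⁻¹ ^ (a : ℕ)) ψ) =
      gaussSum ((ω ^ t) ^ 3) ψ *
        ∑ χ : MulChar F ℂ, ff (ω ^ t) ψ (lam ^ 6)⁻¹ χ * P6 (HH (ω ^ t) ψ χ) := by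
    rw [Finset.mul_sum, Finset.mul_sum]
    refine Finset.sum_congr rfl fun χ _ => ?_
    rw [← mul_assoc, key, mul_assoc]; rfl
  rw [C] at S
  rw [← hH] at A
  rw [← B] at A
  have h6c : (6 : ℂ) ≠ 0 := by norm_num
  apply mul_left_cancel₀ h6c
  linear_combination (Fintype.card F : ℂ) ^ 3 * A + S + 6 * D

end comb

section jac

variable {F : Type} [Field F] [Fintype F]

lemma jacobiS_two (A B : MulChar F ℂ) : jacobiS F ![A, B] = jacobiSum A B := by
  rw [jacobiS, jacobiSum, Finset.sum_filter,
    ← (finTwoArrowEquiv F).symm.sum_comp, Fintype.sum_prod_type]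
  refine Finset.sum_congr rfl fun x _ => ?_
  rw [Finset.sum_eq_single (1 - x)]
  · simp
  · intro y _ hy
    rw [if_neg]
    simp only [finTwoArrowEquiv_symm_apply, Fin.sum_univ_two, Matrix.cons_val_zero,
      Matrix.cons_val_one]
    intro h
    exact hy (eq_sub_of_add_eq' h)
  · simp

lemma jacobiS_three_sum (A B C : MulChar F ℂ) :
    jacobiS F ![A, B, C] = ∑ x : F, A x * ∑ y : F, B y * C (1 - x - y) := by
  rw [jacobiS, Finset.sum_filter, ← (Fin.consEquiv (fun _ : Fin 3 => F)).sum_comp,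
    Fintype.sum_prod_type]
  refine Finset.sum_congr rfl fun x _ => ?_
  rw [Finset.mul_sum, ← (finTwoArrowEquiv F).symm.sum_comp, Fintype.sum_prod_type]
  refine Finset.sum_congr rfl fun y _ => ?_
  rw [Finset.sum_eq_single (1 - x - y)]
  · simp [Fin.consEquiv, Fin.sum_univ_three, Fin.prod_univ_three, mul_assoc]
  · intro z _ hz
    rw [if_neg]
    simp [Fin.consEquiv, Fin.sum_univ_three]
    intro h
    apply hz
    rw [← h]; ring
  · simp

lemma jac_inner_sum (B C : MulChar F ℂ) (hBC : B * C ≠ 1) (u : F) :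
    ∑ y : F, B y * C (u - y) = (B * C) u * jacobiSum B C := by
  by_cases hu : u = 0
  · subst hu
    rw [MulChar.map_zero, zero_mul]
    have : ∀ y, B y * C (0 - y) = C (-1) * (B * C) y := by
      intro y
      rw [zero_sub, neg_eq_neg_one_mul, map_mul, MulChar.mul_apply]; ring
    simp_rw [this]
    rw [← Finset.mul_sum, char_sum, if_neg hBC, mul_zero]
  · rw [← Equiv.sum_comp (Equiv.mulLeft₀ u hu), jacobiSum, Finset.mul_sum]
    refine Finset.sum_congr rfl fun y _ => ?_
    change B (u * y) * C (u - u * y) = _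
    rw [show u - u * y = u * (1 - y) by ring, map_mul, map_mul,
      MulChar.mul_apply]
    ring

lemma jacobiS_three {ψ : AddChar F ℂ} (hψ : ψ ≠ 1) {A B C : MulChar F ℂ} (h : A * (B * C) = 1)
    (hA : A ≠ 1) : jacobiS F ![A, B, C] =
      - (gaussSum A ψ * gaussSum B ψ * gaussSum C ψ) / Fintype.card F := by
  have hi : B * C = A⁻¹ := (inv_eq_of_mul_eq_one_right h).symm
  have hBC : B * C ≠ 1 := by rw [hi]; exact inv_ne_one.mpr hA
  rw [jacobiS_three_sum]
  simp_rw [jac_inner_sum B C hBC, ← mul_assoc]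
  rw [← Finset.sum_mul, ← jacobiSum, hi, jacobiSum_nontrivial_inv hA, jac_eq hψ hBC, hi]
  have hg := gs_mul_inv hψ hA
  have h1 := gs_ne_zero hψ A⁻¹
  have h2 : (Fintype.card F : ℂ) ≠ 0 := card_ne_zero'
  field_simp
  linear_combination (- gaussSum B ψ * gaussSum C ψ) * hg * (-1)

lemma jac_twist (A C : MulChar F ℂ) : jacobiSum A C = A (-1) * jacobiSum A (A * C)⁻¹ := by
  rw [jacobiSum, jacobiSum, Finset.mul_sum]
  have inv : Function.Involutive (fun x : F => if x = 1 then 1 else x / (x - 1)) := by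
    intro x
    by_cases hx : x = 1
    · simp [hx, MulChar.map_zero]
    · have h1 : x - 1 ≠ 0 := sub_ne_zero.mpr hx
      have h2 : x / (x - 1) ≠ 1 := by
        intro h
        rw [div_eq_one_iff_eq h1] at h
        have : (1 : F) = 0 := by linear_combination h
        exact one_ne_zero this
      simp only [if_neg hx, if_neg h2]
      rw [div_sub_one h1]
      field_simp
      ring
  refine Fintype.sum_equiv inv.toPerm _ _ fun x => ?_
  rw [Function.Involutive.coe_toPerm]
  by_cases hx : x = 1
  · simp [hx, MulChar.map_zero]
  · have h1 : x - 1 ≠ 0 := sub_ne_zero.mpr hx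
    have h1' : 1 - x ≠ 0 := sub_ne_zero.mpr (Ne.symm hx)
    simp only [if_neg hx]
    rw [show 1 - x / (x - 1) = (1 - x)⁻¹ by
        field_simp
        ring, MulChar.inv_apply', inv_inv, MulChar.mul_apply, ← mul_assoc, ← mul_assoc, ← map_mul,
      ← map_mul]
    congr 2
    field_simp
    ring

lemma gBinom_eq (A B : MulChar F ℂ) :
    gBinom F A B = B (-1) / (Fintype.card F : ℂ) * jacobiSum A B⁻¹ := by
  rw [gBinom, jacobiS_two]

lemma binom_thm (A : MulChar F ℂ) (u : F) (hu : u ≠ 0) :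
    A⁻¹ (1 - u) = (Fintype.card F : ℂ) / ((Fintype.card F : ℂ) - 1) *
      ∑ χ : MulChar F ℂ, gBinom F (A * χ) χ * χ u := by
  have hq : (Fintype.card F : ℂ) ≠ 0 := card_ne_zero'
  have hq1 : (Fintype.card F : ℂ) - 1 ≠ 0 := card_sub_one_ne_zero
  have e : ∀ χ : MulChar F ℂ, gBinom F (A * χ) χ * χ u =
      1 / (Fintype.card F : ℂ) * ∑ v : F, A⁻¹ (1 - v) * (χ⁻¹ v * χ u) := by
    intro χ
    have h := jac_twist χ⁻¹ A⁻¹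
    rw [mul_inv, inv_inv, inv_inv, mul_comm χ A] at h
    have hn : χ⁻¹ (-1) = χ (-1) := by
      rw [MulChar.inv_apply', inv_neg, inv_one]
    rw [gBinom_eq, jacobiSum_comm, div_mul_eq_mul_div, ← hn, ← h, jacobiSum, div_mul_eq_mul_div,
      one_div, div_eq_inv_mul, Finset.sum_mul]
    congr 1
    refine Finset.sum_congr rfl fun v _ => ?_
    ring
  simp_rw [e]
  rw [← Finset.mul_sum, Finset.sum_comm]
  simp_rw [← Finset.mul_sum]
  rw [Finset.sum_eq_single u]
  · rw [sum_char_inv_mul u u hu hu, if_pos rfl]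
    field_simp
  · intro v _ hv
    by_cases hv0 : v = 0
    · subst hv0
      simp [MulChar.map_zero]
    · rw [sum_char_inv_mul v u hv0 hu, if_neg (Ne.symm hv), mul_zero]
  · simp

lemma greene2F1_eq (A₀ A₁ B₁ : MulChar F ℂ) (x : F) (hx : x ≠ 0) :
    greene2F1 F A₀ A₁ B₁ x = (Fintype.card F : ℂ) / ((Fintype.card F : ℂ) - 1) *
      ∑ χ : MulChar F ℂ, gBinom F (A₀ * χ) χ * gBinom F (A₁ * χ) (B₁ * χ) * χ x := by
  have hq : (Fintype.card F : ℂ) ≠ 0 := card_ne_zero'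
  have e : ∀ y : F, A₁ y * (A₁⁻¹ * B₁) (1 - y) * A₀⁻¹ (1 - x * y) =
      (Fintype.card F : ℂ) / ((Fintype.card F : ℂ) - 1) *
      ∑ χ : MulChar F ℂ, gBinom F (A₀ * χ) χ * χ x * ((A₁ * χ) y * (A₁⁻¹ * B₁) (1 - y)) := by
    intro y
    by_cases hy : y = 0
    · subst hy; simp [MulChar.map_zero]
    · rw [binom_thm A₀ (x * y) (mul_ne_zero hx hy), mul_left_comm, Finset.mul_sum]
      congr 1
      refine Finset.sum_congr rfl fun χ _ => ?_
      rw [map_mul, MulChar.mul_apply A₁ χ]; ring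
  rw [greene2F1, MulChar.one_apply (IsUnit.mk0 x hx), one_mul]
  simp_rw [e]
  rw [← Finset.mul_sum, Finset.sum_comm, mul_left_comm, Finset.mul_sum]
  congr 1
  refine Finset.sum_congr rfl fun χ _ => ?_
  rw [← Finset.mul_sum, ← jacobiSum, jac_twist, show A₁ * χ * (A₁⁻¹ * B₁) = B₁ * χ by
      rw [mul_comm A₁ χ, mul_assoc, mul_inv_cancel_left, mul_comm], gBinom_eq (A₁ * χ)]
  have hs : A₁ (-1) ^ 2 = 1 := by rw [← map_pow]; simp
  rw [MulChar.mul_apply, MulChar.mul_apply, MulChar.mul_apply]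
  linear_combination (gBinom F (A₀ * χ) χ * χ x * B₁ (-1) * χ (-1) / (Fintype.card F : ℂ) * jacobiSum (A₁ * χ) (B₁ * χ)⁻¹) * hs

end jac

section matching

variable {F : Type} [Field F] [Fintype F]
variable {τ : MulChar F ℂ} (hord : orderOf τ = 6) {ψ : AddChar F ℂ} (hψ : ψ ≠ 1)

include hord hψ in
lemma gb (χ : MulChar F ℂ) (a b c : ℕ) (ha : a < 6) (hb : b < 6) (hc : c < 6)
    (h : (b + c) % 6 = a) (hc0 : c ≠ 0) :
    gBinom F (τ ^ a * χ) (τ ^ b * χ) = χ (-1) * τ (-1) ^ b / (Fintype.card F : ℂ) *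
      (gaussSum (χ * τ ^ a) ψ * gaussSum (χ⁻¹ * τ⁻¹ ^ b) ψ / gaussSum (τ ^ c) ψ) := by
  have h6 : τ ^ 6 = 1 := by rw [← hord, pow_orderOf_eq_one]
  have e : τ ^ a = τ ^ b * τ ^ c := by
    rw [← pow_add, ← h]
    conv_rhs => rw [← Nat.mod_add_div (b + c) 6]
    rw [pow_add, pow_mul, h6, one_pow, mul_one]
  have e2 : τ ^ a * χ * (τ ^ b * χ)⁻¹ = τ ^ c := by
    rw [e, mul_inv_eq_iff_eq_mul, mul_comm (τ ^ b), mul_assoc]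
  have e3 : τ ^ c ≠ 1 := by
    intro h
    have := Nat.le_of_dvd (Nat.pos_of_ne_zero hc0) (orderOf_dvd_of_pow_eq_one h)
    omega
  rw [gBinom_eq, jac_eq hψ (by rw [e2]; exact e3), e2, MulChar.mul_apply, mul_comm (τ ^ a),
    show (τ ^ b * χ)⁻¹ = χ⁻¹ * τ⁻¹ ^ b by rw [mul_inv, inv_pow, mul_comm]]
  rw [show (τ ^ b) (-1) = τ (-1) ^ b by
    have := MulChar.pow_apply_coe τ b (-1)
    simpa using this, mul_comm (τ (-1) ^ b)]

lemma neg_one_sq_cases (χ : MulChar F ℂ) : χ (-1) = 1 ∨ χ (-1) = -1 := by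
  have hs : χ (-1) ^ 2 = 1 := by rw [← map_pow]; simp
  exact mul_self_eq_one_iff.mp (by rw [← sq]; exact hs)

lemma Ide_explicit (χ : MulChar F ℂ) (x : F) (n0 n1 n2 n3 n4 n5 : ℕ) :
    Ide τ ψ x ![n0, n1, n2, n3, n4, n5] χ = χ x *
      ((if n0 = 0 then gaussSum (χ * τ ^ 0) ψ else
        χ (-1) * τ (-1) ^ 0 * (Fintype.card F : ℂ) * gaussSum (χ⁻¹ * τ⁻¹ ^ 0) ψ ^ (n0 - 1)) *
      (if n1 = 0 then gaussSum (χ * τ ^ 1) ψ else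
        χ (-1) * τ (-1) ^ 1 * (Fintype.card F : ℂ) * gaussSum (χ⁻¹ * τ⁻¹ ^ 1) ψ ^ (n1 - 1)) *
      (if n2 = 0 then gaussSum (χ * τ ^ 2) ψ else
        χ (-1) * τ (-1) ^ 2 * (Fintype.card F : ℂ) * gaussSum (χ⁻¹ * τ⁻¹ ^ 2) ψ ^ (n2 - 1)) *
      (if n3 = 0 then gaussSum (χ * τ ^ 3) ψ else
        χ (-1) * τ (-1) ^ 3 * (Fintype.card F : ℂ) * gaussSum (χ⁻¹ * τ⁻¹ ^ 3) ψ ^ (n3 - 1)) *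
      (if n4 = 0 then gaussSum (χ * τ ^ 4) ψ else
        χ (-1) * τ (-1) ^ 4 * (Fintype.card F : ℂ) * gaussSum (χ⁻¹ * τ⁻¹ ^ 4) ψ ^ (n4 - 1)) *
      (if n5 = 0 then gaussSum (χ * τ ^ 5) ψ else
        χ (-1) * τ (-1) ^ 5 * (Fintype.card F : ℂ) * gaussSum (χ⁻¹ * τ⁻¹ ^ 5) ψ ^ (n5 - 1))) := by
  have h : ∀ b : ℕ, (χ * τ ^ b) (-1) = χ (-1) * τ (-1) ^ b := by
    intro b
    rw [MulChar.mul_apply]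
    congr 1
    have := MulChar.pow_apply_coe τ b (-1)
    simpa using this
  rw [Ide, Fin.prod_univ_six]
  simp only [h]
  rfl

/-- Termwise matching gives matching with `greeneF`. -/
lemma greene_match (ω : MulChar F ℂ) (hω : ∀ χ : MulChar F ℂ, ∃ j : ℕ, χ = ω ^ j) {m : ℕ}
    (A : Fin (m + 1) → MulChar F ℂ) (B : Fin m → MulChar F ℂ) (x : F) (n : Fin 6 → ℕ) (C : ℂ)
    (h : ∀ χ : MulChar F ℂ, gaussSum (τ ^ 3) ψ * Ide τ ψ x n χ = (Fintype.card F : ℂ) ^ 5 * C *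
      (gBinom F (A 0 * χ) χ * (∏ i : Fin m, gBinom F (A i.succ * χ) (B i * χ)) * χ x)) :
    gaussSum (τ ^ 3) ψ * ∑ χ : MulChar F ℂ, Ide τ ψ x n χ =
      (Fintype.card F : ℂ) ^ 4 * ((Fintype.card F : ℂ) - 1) * (C * greeneF F ω A B x) := by
  have hq1 : (Fintype.card F : ℂ) - 1 ≠ 0 := card_sub_one_ne_zero
  rw [greeneF, sum_gen ω hω (fun χ => gBinom F (A 0 * χ) χ *
    (∏ i : Fin m, gBinom F (A i.succ * χ) (B i * χ)) * χ x), Finset.mul_sum]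
  simp_rw [h]
  rw [← Finset.mul_sum]
  field_simp

/-- Termwise matching gives matching with `greene2F1`. -/
lemma greene2_match (A₀ A₁ B₁ : MulChar F ℂ) (x : F) (hx : x ≠ 0) (n : Fin 6 → ℕ) (C : ℂ)
    (h : ∀ χ : MulChar F ℂ, gaussSum (τ ^ 3) ψ * Ide τ ψ x n χ = (Fintype.card F : ℂ) ^ 5 * C *
      (gBinom F (A₀ * χ) χ * gBinom F (A₁ * χ) (B₁ * χ) * χ x)) :
    gaussSum (τ ^ 3) ψ * ∑ χ : MulChar F ℂ, Ide τ ψ x n χ =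
      (Fintype.card F : ℂ) ^ 4 * ((Fintype.card F : ℂ) - 1) * (C * greene2F1 F A₀ A₁ B₁ x) := by
  have hq1 : (Fintype.card F : ℂ) - 1 ≠ 0 := card_sub_one_ne_zero
  rw [greene2F1_eq _ _ _ _ hx, Finset.mul_sum]
  simp_rw [h]
  rw [← Finset.mul_sum]
  field_simp

include hord hψ in
/-- Arithmetic of the Gauss sums of the powers of `τ`. -/
lemma gs_elim : ∃ G1 G2 G3 : ℂ, G1 ≠ 0 ∧ G2 ≠ 0 ∧ G3 ≠ 0 ∧ gaussSum (τ ^ 1) ψ = G1 ∧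
    gaussSum (τ ^ 2) ψ = G2 ∧ gaussSum (τ ^ 3) ψ = G3 ∧
    gaussSum (τ ^ 4) ψ = τ (-1) * G3 ^ 2 / G2 ∧ gaussSum (τ ^ 5) ψ = G3 ^ 2 / G1 ∧
    (Fintype.card F : ℂ) = τ (-1) * G3 ^ 2 := by
  obtain ⟨v3, v1, v2, hs⟩ := gs_tau_vals hord hψ
  have h1 := gs_ne_zero hψ τ
  have h2 := gs_ne_zero hψ (τ ^ 2)
  have h3 := gs_ne_zero hψ (τ ^ 3)
  refine ⟨_, _, _, ?_, h2, h3, rfl, rfl, rfl, ?_, ?_, ?_⟩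
  · rwa [pow_one]
  · rw [v3, eq_div_iff h2]
    linear_combination v2 - (Fintype.card F : ℂ) * hs
  · rw [pow_one, v3, eq_div_iff h1]
    linear_combination v1
  · rw [v3]; linear_combination - (Fintype.card F : ℂ) * hs

end matching

section terms

variable {F : Type} [Field F] [Fintype F]
variable {τ : MulChar F ℂ} (hord : orderOf τ = 6) {ψ : AddChar F ℂ} (hψ : ψ ≠ 1)

include hord hψ in
lemma gb0 (χ : MulChar F ℂ) (a : ℕ) (ha : a < 6) (ha0 : a ≠ 0) :
    gBinom F (τ ^ a * χ) χ = χ (-1) / (Fintype.card F : ℂ) *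
      (gaussSum (χ * τ ^ a) ψ * gaussSum (χ⁻¹ * τ⁻¹ ^ 0) ψ / gaussSum (τ ^ a) ψ) := by
  have h := gb hord hψ χ a 0 a ha (by norm_num) ha (by rw [zero_add, Nat.mod_eq_of_lt ha]) ha0
  rw [pow_zero, one_mul, pow_zero, mul_one] at h
  exact h

include hord hψ in
lemma j3 (a b c : ℕ) (h : (a + (b + c)) % 6 = 0) (ha : a % 6 ≠ 0) :
    jacobiS F ![τ ^ a, τ ^ b, τ ^ c] =
      - (gaussSum (τ ^ a) ψ * gaussSum (τ ^ b) ψ * gaussSum (τ ^ c) ψ) / (Fintype.card F : ℂ) := by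
  refine jacobiS_three hψ ?_ ?_
  · rw [← pow_add, ← pow_add, ← orderOf_dvd_iff_pow_eq_one, hord]
    exact Nat.dvd_of_mod_eq_zero h
  · intro h1
    rw [← orderOf_dvd_iff_pow_eq_one, hord] at h1
    exact ha (Nat.mod_eq_zero_of_dvd h1)

include hord hψ in
lemma j11 : jacobiS F ![τ ^ 1, τ ^ 1] =
      gaussSum (τ ^ 1) ψ * gaussSum (τ ^ 1) ψ / gaussSum (τ ^ 2) ψ := by
  rw [jacobiS_two, jac_eq hψ, ← pow_add]
  intro h1
  rw [← pow_add, ← orderOf_dvd_iff_pow_eq_one, hord] at h1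
  revert h1; decide

variable (ω : MulChar F ℂ) (hω : ∀ χ : MulChar F ℂ, ∃ j : ℕ, χ = ω ^ j) (x : F)

include hord hψ hω in
lemma termEq0 : gaussSum (τ ^ 3) ψ * ∑ χ : MulChar F ℂ, Ide τ ψ x (nn 0) χ =
    (Fintype.card F : ℂ) ^ 4 * ((Fintype.card F : ℂ) - 1) *
      ((Fintype.card F : ℂ) ^ 4 *
        greeneF F ω ![τ ^ 1, τ ^ 2, τ ^ 3, τ ^ 4, τ ^ 5] ![τ ^ 0, τ ^ 0, τ ^ 0, τ ^ 0] x) := by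
  refine greene_match ω hω _ _ _ _ _ fun χ => ?_
  rw [show nn 0 = ![6, 0, 0, 0, 0, 0] from rfl, Ide_explicit]
  rw [Fin.prod_univ_four]
  change _ = (Fintype.card F : ℂ) ^ 5 * _ * (gBinom F (τ ^ 1 * χ) χ * (
    gBinom F (τ ^ 2 * χ) (τ ^ 0 * χ) * gBinom F (τ ^ 3 * χ) (τ ^ 0 * χ) * gBinom F (τ ^ 4 * χ) (τ ^ 0 * χ) * gBinom F (τ ^ 5 * χ) (τ ^ 0 * χ)) * χ x)
  rw [gb0 hord hψ χ 1 (by norm_num) (by norm_num),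
    gb hord hψ χ 2 0 2 (by norm_num) (by norm_num) (by norm_num) (by norm_num) (by norm_num),
    gb hord hψ χ 3 0 3 (by norm_num) (by norm_num) (by norm_num) (by norm_num) (by norm_num),
    gb hord hψ χ 4 0 4 (by norm_num) (by norm_num) (by norm_num) (by norm_num) (by norm_num),
    gb hord hψ χ 5 0 5 (by norm_num) (by norm_num) (by norm_num) (by norm_num) (by norm_num)]
  obtain ⟨G1, G2, G3, h1, h2, h3, e1, e2, e3, e4, e5, eq⟩ := gs_elim hord hψ
  simp only [e1, e2, e3, e4, e5, eq]
  norm_num only [if_true, if_false]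
  rcases neg_one_sq_cases τ with hs | hs <;> rcases neg_one_sq_cases χ with hc | hc <;>
    rw [hs, hc] <;> field_simp <;> ring

include hord hψ hω in
lemma termEq1 : gaussSum (τ ^ 3) ψ * ∑ χ : MulChar F ℂ, Ide τ ψ x (nn 1) χ =
    (Fintype.card F : ℂ) ^ 4 * ((Fintype.card F : ℂ) - 1) *
      (((Fintype.card F : ℂ) ^ 3 * τ (-1)) *
        greeneF F ω ![τ ^ 2, τ ^ 3, τ ^ 4] ![τ ^ 0, τ ^ 0] x) := by
  refine greene_match ω hω _ _ _ _ _ fun χ => ?_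
  rw [show nn 1 = ![4, 1, 0, 0, 0, 1] from rfl, Ide_explicit]
  rw [Fin.prod_univ_two]
  change _ = (Fintype.card F : ℂ) ^ 5 * _ * (gBinom F (τ ^ 2 * χ) χ * (
    gBinom F (τ ^ 3 * χ) (τ ^ 0 * χ) * gBinom F (τ ^ 4 * χ) (τ ^ 0 * χ)) * χ x)
  rw [gb0 hord hψ χ 2 (by norm_num) (by norm_num),
    gb hord hψ χ 3 0 3 (by norm_num) (by norm_num) (by norm_num) (by norm_num) (by norm_num),
    gb hord hψ χ 4 0 4 (by norm_num) (by norm_num) (by norm_num) (by norm_num) (by norm_num)]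
  obtain ⟨G1, G2, G3, h1, h2, h3, e1, e2, e3, e4, e5, eq⟩ := gs_elim hord hψ
  simp only [e1, e2, e3, e4, e5, eq]
  norm_num only [if_true, if_false]
  rcases neg_one_sq_cases τ with hs | hs <;> rcases neg_one_sq_cases χ with hc | hc <;>
    rw [hs, hc] <;> field_simp <;> ring

include hord hψ hω in
lemma termEq2 : gaussSum (τ ^ 3) ψ * ∑ χ : MulChar F ℂ, Ide τ ψ x (nn 2) χ =
    (Fintype.card F : ℂ) ^ 4 * ((Fintype.card F : ℂ) - 1) *
      ((Fintype.card F : ℂ) ^ 3 *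
        greeneF F ω ![τ ^ 1, τ ^ 3, τ ^ 5] ![τ ^ 0, τ ^ 0] x) := by
  refine greene_match ω hω _ _ _ _ _ fun χ => ?_
  rw [show nn 2 = ![4, 0, 1, 0, 1, 0] from rfl, Ide_explicit]
  rw [Fin.prod_univ_two]
  change _ = (Fintype.card F : ℂ) ^ 5 * _ * (gBinom F (τ ^ 1 * χ) χ * (
    gBinom F (τ ^ 3 * χ) (τ ^ 0 * χ) * gBinom F (τ ^ 5 * χ) (τ ^ 0 * χ)) * χ x)
  rw [gb0 hord hψ χ 1 (by norm_num) (by norm_num),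
    gb hord hψ χ 3 0 3 (by norm_num) (by norm_num) (by norm_num) (by norm_num) (by norm_num),
    gb hord hψ χ 5 0 5 (by norm_num) (by norm_num) (by norm_num) (by norm_num) (by norm_num)]
  obtain ⟨G1, G2, G3, h1, h2, h3, e1, e2, e3, e4, e5, eq⟩ := gs_elim hord hψ
  simp only [e1, e2, e3, e4, e5, eq]
  norm_num only [if_true, if_false]
  rcases neg_one_sq_cases τ with hs | hs <;> rcases neg_one_sq_cases χ with hc | hc <;>
    rw [hs, hc] <;> field_simp <;> ring

include hord hψ hω in
lemma termEq3 : gaussSum (τ ^ 3) ψ * ∑ χ : MulChar F ℂ, Ide τ ψ x (nn 3) χ =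
    (Fintype.card F : ℂ) ^ 4 * ((Fintype.card F : ℂ) - 1) *
      ((-((Fintype.card F : ℂ) ^ 3 * τ (-1) * jacobiS F ![τ ^ 3, τ ^ 4, τ ^ 5])) *
        greeneF F ω ![τ ^ 1, τ ^ 5, τ ^ 4, τ ^ 2] ![τ ^ 0, τ ^ 0, τ ^ 3] x) := by
  refine greene_match ω hω _ _ _ _ _ fun χ => ?_
  rw [show nn 3 = ![4, 0, 0, 2, 0, 0] from rfl, Ide_explicit]
  rw [Fin.prod_univ_three]
  change _ = (Fintype.card F : ℂ) ^ 5 * _ * (gBinom F (τ ^ 1 * χ) χ * (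
    gBinom F (τ ^ 5 * χ) (τ ^ 0 * χ) * gBinom F (τ ^ 4 * χ) (τ ^ 0 * χ) * gBinom F (τ ^ 2 * χ) (τ ^ 3 * χ)) * χ x)
  rw [gb0 hord hψ χ 1 (by norm_num) (by norm_num),
    gb hord hψ χ 5 0 5 (by norm_num) (by norm_num) (by norm_num) (by norm_num) (by norm_num),
    gb hord hψ χ 4 0 4 (by norm_num) (by norm_num) (by norm_num) (by norm_num) (by norm_num),
    gb hord hψ χ 2 3 5 (by norm_num) (by norm_num) (by norm_num) (by norm_num) (by norm_num),
    j3 hord hψ 3 4 5 (by norm_num) (by norm_num)]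
  obtain ⟨G1, G2, G3, h1, h2, h3, e1, e2, e3, e4, e5, eq⟩ := gs_elim hord hψ
  simp only [e1, e2, e3, e4, e5, eq]
  norm_num only [if_true, if_false]
  rcases neg_one_sq_cases τ with hs | hs <;> rcases neg_one_sq_cases χ with hc | hc <;>
    rw [hs, hc] <;> field_simp <;> ring

include hord hψ hω in
lemma termEq4 : gaussSum (τ ^ 3) ψ * ∑ χ : MulChar F ℂ, Ide τ ψ x (nn 4) χ =
    (Fintype.card F : ℂ) ^ 4 * ((Fintype.card F : ℂ) - 1) *
      ((-((Fintype.card F : ℂ) ^ 3 * τ (-1) * jacobiS F ![τ ^ 1, τ ^ 2, τ ^ 3])) *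
        greeneF F ω ![τ ^ 1, τ ^ 3, τ ^ 4, τ ^ 5] ![τ ^ 0, τ ^ 2, τ ^ 2] x) := by
  refine greene_match ω hω _ _ _ _ _ fun χ => ?_
  rw [show nn 4 = ![3, 0, 3, 0, 0, 0] from rfl, Ide_explicit]
  rw [Fin.prod_univ_three]
  change _ = (Fintype.card F : ℂ) ^ 5 * _ * (gBinom F (τ ^ 1 * χ) χ * (
    gBinom F (τ ^ 3 * χ) (τ ^ 0 * χ) * gBinom F (τ ^ 4 * χ) (τ ^ 2 * χ) * gBinom F (τ ^ 5 * χ) (τ ^ 2 * χ)) * χ x)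
  rw [gb0 hord hψ χ 1 (by norm_num) (by norm_num),
    gb hord hψ χ 3 0 3 (by norm_num) (by norm_num) (by norm_num) (by norm_num) (by norm_num),
    gb hord hψ χ 4 2 2 (by norm_num) (by norm_num) (by norm_num) (by norm_num) (by norm_num),
    gb hord hψ χ 5 2 3 (by norm_num) (by norm_num) (by norm_num) (by norm_num) (by norm_num),
    j3 hord hψ 1 2 3 (by norm_num) (by norm_num)]
  obtain ⟨G1, G2, G3, h1, h2, h3, e1, e2, e3, e4, e5, eq⟩ := gs_elim hord hψ
  simp only [e1, e2, e3, e4, e5, eq]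
  norm_num only [if_true, if_false]
  rcases neg_one_sq_cases τ with hs | hs <;> rcases neg_one_sq_cases χ with hc | hc <;>
    rw [hs, hc] <;> field_simp <;> ring

include hord hψ hω in
lemma termEq5 : gaussSum (τ ^ 3) ψ * ∑ χ : MulChar F ℂ, Ide τ ψ x (nn 5) χ =
    (Fintype.card F : ℂ) ^ 4 * ((Fintype.card F : ℂ) - 1) *
      (((Fintype.card F : ℂ) ^ 2 * τ (-1) * jacobiS F ![τ ^ 1, τ ^ 1, τ ^ 4] * jacobiS F ![τ ^ 3, τ ^ 4, τ ^ 5]) *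
        greeneF F ω ![τ ^ 1, τ ^ 4, τ ^ 3] ![τ ^ 0, τ ^ 5] x) := by
  refine greene_match ω hω _ _ _ _ _ fun χ => ?_
  rw [show nn 5 = ![3, 0, 1, 0, 0, 2] from rfl, Ide_explicit]
  rw [Fin.prod_univ_two]
  change _ = (Fintype.card F : ℂ) ^ 5 * _ * (gBinom F (τ ^ 1 * χ) χ * (
    gBinom F (τ ^ 4 * χ) (τ ^ 0 * χ) * gBinom F (τ ^ 3 * χ) (τ ^ 5 * χ)) * χ x)
  rw [gb0 hord hψ χ 1 (by norm_num) (by norm_num),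
    gb hord hψ χ 4 0 4 (by norm_num) (by norm_num) (by norm_num) (by norm_num) (by norm_num),
    gb hord hψ χ 3 5 4 (by norm_num) (by norm_num) (by norm_num) (by norm_num) (by norm_num),
    j3 hord hψ 3 4 5 (by norm_num) (by norm_num),
    j3 hord hψ 1 1 4 (by norm_num) (by norm_num)]
  obtain ⟨G1, G2, G3, h1, h2, h3, e1, e2, e3, e4, e5, eq⟩ := gs_elim hord hψ
  simp only [e1, e2, e3, e4, e5, eq]
  norm_num only [if_true, if_false]
  rcases neg_one_sq_cases τ with hs | hs <;> rcases neg_one_sq_cases χ with hc | hc <;>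
    rw [hs, hc] <;> field_simp <;> ring

include hord hψ hω in
lemma termEq6 : gaussSum (τ ^ 3) ψ * ∑ χ : MulChar F ℂ, Ide τ ψ x (nn 6) χ =
    (Fintype.card F : ℂ) ^ 4 * ((Fintype.card F : ℂ) - 1) *
      (((Fintype.card F : ℂ) ^ 2 * jacobiS F ![τ ^ 2, τ ^ 2, τ ^ 2] * jacobiS F ![τ ^ 3, τ ^ 4, τ ^ 5]) *
        greeneF F ω ![τ ^ 2, τ ^ 5, τ ^ 3] ![τ ^ 0, τ ^ 1] x) := by
  refine greene_match ω hω _ _ _ _ _ fun χ => ?_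
  rw [show nn 6 = ![3, 2, 0, 0, 1, 0] from rfl, Ide_explicit]
  rw [Fin.prod_univ_two]
  change _ = (Fintype.card F : ℂ) ^ 5 * _ * (gBinom F (τ ^ 2 * χ) χ * (
    gBinom F (τ ^ 5 * χ) (τ ^ 0 * χ) * gBinom F (τ ^ 3 * χ) (τ ^ 1 * χ)) * χ x)
  rw [gb0 hord hψ χ 2 (by norm_num) (by norm_num),
    gb hord hψ χ 5 0 5 (by norm_num) (by norm_num) (by norm_num) (by norm_num) (by norm_num),
    gb hord hψ χ 3 1 2 (by norm_num) (by norm_num) (by norm_num) (by norm_num) (by norm_num),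
    j3 hord hψ 3 4 5 (by norm_num) (by norm_num),
    j3 hord hψ 2 2 2 (by norm_num) (by norm_num)]
  obtain ⟨G1, G2, G3, h1, h2, h3, e1, e2, e3, e4, e5, eq⟩ := gs_elim hord hψ
  simp only [e1, e2, e3, e4, e5, eq]
  norm_num only [if_true, if_false]
  rcases neg_one_sq_cases τ with hs | hs <;> rcases neg_one_sq_cases χ with hc | hc <;>
    rw [hs, hc] <;> field_simp <;> ring

include hord hψ hω in
lemma termEq7 : gaussSum (τ ^ 3) ψ * ∑ χ : MulChar F ℂ, Ide τ ψ x (nn 7) χ =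
    (Fintype.card F : ℂ) ^ 4 * ((Fintype.card F : ℂ) - 1) *
      ((Fintype.card F : ℂ) ^ 3 *
        greeneF F ω ![τ ^ 3, τ ^ 4, τ ^ 5] ![τ ^ 1, τ ^ 2] x) := by
  refine greene_match ω hω _ _ _ _ _ fun χ => ?_
  rw [show nn 7 = ![2, 2, 2, 0, 0, 0] from rfl, Ide_explicit]
  rw [Fin.prod_univ_two]
  change _ = (Fintype.card F : ℂ) ^ 5 * _ * (gBinom F (τ ^ 3 * χ) χ * (
    gBinom F (τ ^ 4 * χ) (τ ^ 1 * χ) * gBinom F (τ ^ 5 * χ) (τ ^ 2 * χ)) * χ x)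
  rw [gb0 hord hψ χ 3 (by norm_num) (by norm_num),
    gb hord hψ χ 4 1 3 (by norm_num) (by norm_num) (by norm_num) (by norm_num) (by norm_num),
    gb hord hψ χ 5 2 3 (by norm_num) (by norm_num) (by norm_num) (by norm_num) (by norm_num)]
  obtain ⟨G1, G2, G3, h1, h2, h3, e1, e2, e3, e4, e5, eq⟩ := gs_elim hord hψ
  simp only [e1, e2, e3, e4, e5, eq]
  norm_num only [if_true, if_false]
  rcases neg_one_sq_cases τ with hs | hs <;> rcases neg_one_sq_cases χ with hc | hc <;>
    rw [hs, hc] <;> field_simp <;> ring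

include hord hψ hω in
lemma termEq8 : gaussSum (τ ^ 3) ψ * ∑ χ : MulChar F ℂ, Ide τ ψ x (nn 8) χ =
    (Fintype.card F : ℂ) ^ 4 * ((Fintype.card F : ℂ) - 1) *
      ((-((Fintype.card F : ℂ) ^ 2 * jacobiS F ![τ ^ 1, τ ^ 1] * jacobiS F ![τ ^ 1, τ ^ 2, τ ^ 3])) *
        greeneF F ω ![τ ^ 1, τ ^ 3, τ ^ 5] ![τ ^ 2, τ ^ 4] x) := by
  refine greene_match ω hω _ _ _ _ _ fun χ => ?_
  rw [show nn 8 = ![2, 0, 2, 0, 2, 0] from rfl, Ide_explicit]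
  rw [Fin.prod_univ_two]
  change _ = (Fintype.card F : ℂ) ^ 5 * _ * (gBinom F (τ ^ 1 * χ) χ * (
    gBinom F (τ ^ 3 * χ) (τ ^ 2 * χ) * gBinom F (τ ^ 5 * χ) (τ ^ 4 * χ)) * χ x)
  rw [gb0 hord hψ χ 1 (by norm_num) (by norm_num),
    gb hord hψ χ 3 2 1 (by norm_num) (by norm_num) (by norm_num) (by norm_num) (by norm_num),
    gb hord hψ χ 5 4 1 (by norm_num) (by norm_num) (by norm_num) (by norm_num) (by norm_num),
    j3 hord hψ 1 2 3 (by norm_num) (by norm_num),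
    j11 hord hψ]
  obtain ⟨G1, G2, G3, h1, h2, h3, e1, e2, e3, e4, e5, eq⟩ := gs_elim hord hψ
  simp only [e1, e2, e3, e4, e5, eq]
  norm_num only [if_true, if_false]
  rcases neg_one_sq_cases τ with hs | hs <;> rcases neg_one_sq_cases χ with hc | hc <;>
    rw [hs, hc] <;> field_simp <;> ring

include hord hψ in
lemma termEq9 (hx : x ≠ 0) : gaussSum (τ ^ 3) ψ * ∑ χ : MulChar F ℂ, Ide τ ψ x (nn 9) χ =
    (Fintype.card F : ℂ) ^ 4 * ((Fintype.card F : ℂ) - 1) *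
      ((-((Fintype.card F : ℂ) ^ 2 * jacobiS F ![τ ^ 1, τ ^ 2, τ ^ 3])) *
        greene2F1 F (τ ^ 1) (τ ^ 2) (τ ^ 0) x) := by
  refine greene2_match _ _ _ _ hx _ _ fun χ => ?_
  rw [show nn 9 = ![3, 0, 0, 1, 1, 1] from rfl, Ide_explicit]
  change _ = (Fintype.card F : ℂ) ^ 5 * _ * (gBinom F (τ ^ 1 * χ) χ * gBinom F (τ ^ 2 * χ) (τ ^ 0 * χ) * χ x)
  rw [gb0 hord hψ χ 1 (by norm_num) (by norm_num),
    gb hord hψ χ 2 0 2 (by norm_num) (by norm_num) (by norm_num) (by norm_num) (by norm_num),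
    j3 hord hψ 1 2 3 (by norm_num) (by norm_num)]
  obtain ⟨G1, G2, G3, h1, h2, h3, e1, e2, e3, e4, e5, eq⟩ := gs_elim hord hψ
  simp only [e1, e2, e3, e4, e5, eq]
  norm_num only [if_true, if_false]
  rcases neg_one_sq_cases τ with hs | hs <;> rcases neg_one_sq_cases χ with hc | hc <;>
    rw [hs, hc] <;> field_simp <;> ring

include hord hψ in
lemma termEq10 (hx : x ≠ 0) : gaussSum (τ ^ 3) ψ * ∑ χ : MulChar F ℂ, Ide τ ψ x (nn 10) χ =
    (Fintype.card F : ℂ) ^ 4 * ((Fintype.card F : ℂ) - 1) *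
      ((-((Fintype.card F : ℂ) ^ 2 * jacobiS F ![τ ^ 3, τ ^ 4, τ ^ 5])) *
        greene2F1 F (τ ^ 4) (τ ^ 5) (τ ^ 0) x) := by
  refine greene2_match _ _ _ _ hx _ _ fun χ => ?_
  rw [show nn 10 = ![3, 1, 1, 1, 0, 0] from rfl, Ide_explicit]
  change _ = (Fintype.card F : ℂ) ^ 5 * _ * (gBinom F (τ ^ 4 * χ) χ * gBinom F (τ ^ 5 * χ) (τ ^ 0 * χ) * χ x)
  rw [gb0 hord hψ χ 4 (by norm_num) (by norm_num),
    gb hord hψ χ 5 0 5 (by norm_num) (by norm_num) (by norm_num) (by norm_num) (by norm_num),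
    j3 hord hψ 3 4 5 (by norm_num) (by norm_num)]
  obtain ⟨G1, G2, G3, h1, h2, h3, e1, e2, e3, e4, e5, eq⟩ := gs_elim hord hψ
  simp only [e1, e2, e3, e4, e5, eq]
  norm_num only [if_true, if_false]
  rcases neg_one_sq_cases τ with hs | hs <;> rcases neg_one_sq_cases χ with hc | hc <;>
    rw [hs, hc] <;> field_simp <;> ring

include hord hψ in
lemma termEq11 (hx : x ≠ 0) : gaussSum (τ ^ 3) ψ * ∑ χ : MulChar F ℂ, Ide τ ψ x (nn 11) χ =
    (Fintype.card F : ℂ) ^ 4 * ((Fintype.card F : ℂ) - 1) *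
      ((-((Fintype.card F : ℂ) ^ 2 * jacobiS F ![τ ^ 1, τ ^ 2, τ ^ 3])) *
        greene2F1 F (τ ^ 2) (τ ^ 4) (τ ^ 3) x) := by
  refine greene2_match _ _ _ _ hx _ _ fun χ => ?_
  rw [show nn 11 = ![2, 1, 0, 2, 0, 1] from rfl, Ide_explicit]
  change _ = (Fintype.card F : ℂ) ^ 5 * _ * (gBinom F (τ ^ 2 * χ) χ * gBinom F (τ ^ 4 * χ) (τ ^ 3 * χ) * χ x)
  rw [gb0 hord hψ χ 2 (by norm_num) (by norm_num),
    gb hord hψ χ 4 3 1 (by norm_num) (by norm_num) (by norm_num) (by norm_num) (by norm_num),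
    j3 hord hψ 1 2 3 (by norm_num) (by norm_num)]
  obtain ⟨G1, G2, G3, h1, h2, h3, e1, e2, e3, e4, e5, eq⟩ := gs_elim hord hψ
  simp only [e1, e2, e3, e4, e5, eq]
  norm_num only [if_true, if_false]
  rcases neg_one_sq_cases τ with hs | hs <;> rcases neg_one_sq_cases χ with hc | hc <;>
    rw [hs, hc] <;> field_simp <;> ring

include hord hψ in
lemma termEq12 (hx : x ≠ 0) : gaussSum (τ ^ 3) ψ * ∑ χ : MulChar F ℂ, Ide τ ψ x (nn 12) χ =
    (Fintype.card F : ℂ) ^ 4 * ((Fintype.card F : ℂ) - 1) *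
      ((-((Fintype.card F : ℂ) ^ 2 * jacobiS F ![τ ^ 1, τ ^ 2, τ ^ 3])) *
        greene2F1 F (τ ^ 2) (τ ^ 5) (τ ^ 4) x) := by
  refine greene2_match _ _ _ _ hx _ _ fun χ => ?_
  rw [show nn 12 = ![2, 1, 0, 1, 2, 0] from rfl, Ide_explicit]
  change _ = (Fintype.card F : ℂ) ^ 5 * _ * (gBinom F (τ ^ 2 * χ) χ * gBinom F (τ ^ 5 * χ) (τ ^ 4 * χ) * χ x)
  rw [gb0 hord hψ χ 2 (by norm_num) (by norm_num),
    gb hord hψ χ 5 4 1 (by norm_num) (by norm_num) (by norm_num) (by norm_num) (by norm_num),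
    j3 hord hψ 1 2 3 (by norm_num) (by norm_num)]
  obtain ⟨G1, G2, G3, h1, h2, h3, e1, e2, e3, e4, e5, eq⟩ := gs_elim hord hψ
  simp only [e1, e2, e3, e4, e5, eq]
  norm_num only [if_true, if_false]
  rcases neg_one_sq_cases τ with hs | hs <;> rcases neg_one_sq_cases χ with hc | hc <;>
    rw [hs, hc] <;> field_simp <;> ring

end terms

section last

variable {F : Type} [Field F] [Fintype F]
variable {τ : MulChar F ℂ} (hord : orderOf τ = 6) {ψ : AddChar F ℂ} (hψ : ψ ≠ 1)

include hord hψ in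
lemma termEq13 (x : F) (hx : x ≠ 0) :
    gaussSum (τ ^ 3) ψ * ∑ χ : MulChar F ℂ, Ide τ ψ x (nn 13) χ =
    (Fintype.card F : ℂ) ^ 4 * ((Fintype.card F : ℂ) - 1) *
      ((Fintype.card F : ℂ) ^ 2 * τ (-1) * (τ ^ 3) (1 - x)) := by
  have h6 : τ ^ 6 = 1 := by rw [← hord, pow_orderOf_eq_one]
  have hi : (τ ^ 3)⁻¹ = τ ^ 3 := by rw [inv_eq_iff_mul_eq_one, ← pow_add, h6]
  have hq1 : (Fintype.card F : ℂ) - 1 ≠ 0 := card_sub_one_ne_zero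
  have b := binom_thm (τ ^ 3) x hx
  rw [hi] at b
  rw [b, Finset.mul_sum]
  have key : ∀ χ : MulChar F ℂ, gaussSum (τ ^ 3) ψ * Ide τ ψ x (nn 13) χ =
      (Fintype.card F : ℂ) ^ 7 * τ (-1) * (gBinom F (τ ^ 3 * χ) χ * χ x) := by
    intro χ
    rw [show nn 13 = ![2, 1, 1, 0, 1, 1] from rfl, Ide_explicit]
    rw [gb0 hord hψ χ 3 (by norm_num) (by norm_num)]
    obtain ⟨G1, G2, G3, h1, h2, h3, e1, e2, e3, e4, e5, eq⟩ := gs_elim hord hψ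
    simp only [e1, e2, e3, e4, e5, eq]
    norm_num only [if_true, if_false]
    rcases neg_one_sq_cases τ with hs | hs <;> rcases neg_one_sq_cases χ with hc | hc <;>
      rw [hs, hc] <;> field_simp <;> ring
  simp_rw [key]
  rw [← Finset.mul_sum]
  field_simp

end last

/-- Theorem 1.3 (main theorem): the number of rational points on the Dwork hypersurface of
degree six in terms of Greene's hypergeometric functions and Jacobi sums. -/
theorem dwork_six_point_count (p e q t : ℕ) [Fact p.Prime] (F : Type) [Field F] [Fintype F]
    (he : 0 < e) (hq : q = Fintype.card F) (hqe : q = p ^ e) (hmod : q % 6 = 1)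
    (ht : t = (q - 1) / 6)
    (ω : MulChar F ℂ) (hω : ∀ χ : MulChar F ℂ, ∃ j : ℕ, χ = ω ^ j)
    (ω₆ ω₃ ω₂ : MulChar F ℂ)
    (hω₆ : ω₆ = ω ^ t) (hω₃ : ω₃ = ω ^ (2 * t)) (hω₂ : ω₂ = ω ^ (3 * t))
    (lam : F) (hlam : lam ≠ 0) (hlam6 : lam ^ 6 ≠ 1) :
    (dworkCount F 6 lam : ℂ) =
      ((q : ℂ) ^ 5 - 1) / ((q : ℂ) - 1) + 360 * (q : ℂ) ^ 2 * ω₂ (1 - lam ^ 6) +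
      (q : ℂ) ^ 4 * greeneF F ω ![ω₆, ω₃, ω₂, ω₃⁻¹, ω₆⁻¹] ![1, 1, 1, 1] (lam ^ 6)⁻¹ +
      30 * (q : ℂ) ^ 3 * ω₆ (-1) * greeneF F ω ![ω₃, ω₂, ω₃⁻¹] ![1, 1] (lam ^ 6)⁻¹ +
      30 * (q : ℂ) ^ 3 * greeneF F ω ![ω₆, ω₂, ω₆⁻¹] ![1, 1] (lam ^ 6)⁻¹ -
      15 * (q : ℂ) ^ 3 * ω₆ (-1) * jacobiS F ![ω₂, ω₃⁻¹, ω₆⁻¹] *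
        greeneF F ω ![ω₆, ω₆⁻¹, ω₃⁻¹, ω₃] ![1, 1, ω₂] (lam ^ 6)⁻¹ -
      20 * (q : ℂ) ^ 3 * ω₆ (-1) * jacobiS F ![ω₆, ω₃, ω₂] *
        greeneF F ω ![ω₆, ω₂, ω₃⁻¹, ω₆⁻¹] ![1, ω₃, ω₃] (lam ^ 6)⁻¹ +
      60 * (q : ℂ) ^ 2 * ω₆ (-1) * jacobiS F ![ω₆, ω₆, ω₃⁻¹] * jacobiS F ![ω₂, ω₃⁻¹, ω₆⁻¹] *
        greeneF F ω ![ω₆, ω₃⁻¹, ω₂] ![1, ω₆⁻¹] (lam ^ 6)⁻¹ +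
      60 * (q : ℂ) ^ 2 * jacobiS F ![ω₃, ω₃, ω₃] * jacobiS F ![ω₂, ω₃⁻¹, ω₆⁻¹] *
        greeneF F ω ![ω₃, ω₆⁻¹, ω₂] ![1, ω₆] (lam ^ 6)⁻¹ +
      90 * (q : ℂ) ^ 3 * greeneF F ω ![ω₂, ω₃⁻¹, ω₆⁻¹] ![ω₆, ω₃] (lam ^ 6)⁻¹ -
      30 * (q : ℂ) ^ 2 * jacobiS F ![ω₆, ω₆] * jacobiS F ![ω₆, ω₃, ω₂] *
        greeneF F ω ![ω₆, ω₂, ω₆⁻¹] ![ω₃, ω₃⁻¹] (lam ^ 6)⁻¹ -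
      120 * (q : ℂ) ^ 2 * jacobiS F ![ω₆, ω₃, ω₂] * greene2F1 F ω₆ ω₃ 1 (lam ^ 6)⁻¹ -
      120 * (q : ℂ) ^ 2 * jacobiS F ![ω₂, ω₃⁻¹, ω₆⁻¹] * greene2F1 F ω₃⁻¹ ω₆⁻¹ 1 (lam ^ 6)⁻¹ -
      180 * (q : ℂ) ^ 2 * jacobiS F ![ω₆, ω₃, ω₂] * greene2F1 F ω₃ ω₃⁻¹ ω₂ (lam ^ 6)⁻¹ -
      180 * (q : ℂ) ^ 2 * jacobiS F ![ω₆, ω₃, ω₂] * greene2F1 F ω₃ ω₆⁻¹ ω₃⁻¹ (lam ^ 6)⁻¹ := by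
  have hcard : Fintype.card F % 6 = 1 := by rw [← hq]; exact hmod
  have ht6 : 6 * t = Fintype.card F - 1 := by rw [← hq, ht]; omega
  subst hq
  have hc0 : ((Fintype.card F : ℕ) : F) = 0 := FiniteField.cast_card_eq_zero F
  have h2 : (2 : F) ≠ 0 := by
    intro h
    have e : Fintype.card F = 2 * (Fintype.card F / 2) + 1 := by omega
    rw [e] at hc0
    push_cast at hc0
    rw [h, zero_mul, zero_add] at hc0
    exact one_ne_zero hc0
  have h3 : (3 : F) ≠ 0 := by
    intro h
    have e : Fintype.card F = 3 * (Fintype.card F / 3) + 1 := by omega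
    rw [e] at hc0
    push_cast at hc0
    rw [h, zero_mul, zero_add] at hc0
    exact one_ne_zero hc0
  obtain ⟨ψ, hψ⟩ := exists_primitive F
  have M := main_ide ω hω t ht6 h2 h3 hψ lam hlam
  have hord : orderOf (ω ^ t) = 6 := orderOf_gen_pow ω hω 6 t ht6
  have e3 : ω₃ = (ω ^ t) ^ 2 := by rw [hω₃, ← pow_mul, mul_comm]
  have e2 : ω₂ = (ω ^ t) ^ 3 := by rw [hω₂, ← pow_mul, mul_comm]
  rw [e3, e2, hω₆]
  generalize ω ^ t = τ at *
  have hlx : (lam ^ 6)⁻¹ ≠ 0 := inv_ne_zero (pow_ne_zero _ hlam)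
  have h6 : τ ^ 6 = 1 := by rw [← hord, pow_orderOf_eq_one]
  have i1 : τ⁻¹ = τ ^ 5 := by rw [inv_eq_iff_mul_eq_one, ← pow_succ', h6]
  have i2 : (τ ^ 2)⁻¹ = τ ^ 4 := by rw [inv_eq_iff_mul_eq_one, ← pow_add, h6]
  rw [i1, i2]
  have hl : (τ ^ 3) (1 - (lam ^ 6)⁻¹) = τ (-1) * (τ ^ 3) (1 - lam ^ 6) := by
    have hl6 : τ (lam ^ 6) = 1 := by
      rw [map_pow, ← MulChar.pow_apply' _ (by norm_num), h6,
        MulChar.one_apply (IsUnit.mk0 _ hlam)]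
    have hs : τ (-1) ^ 3 = τ (-1) := by
      rcases neg_one_sq_cases τ with h | h <;> rw [h] <;> norm_num
    have hm : (1 - lam ^ 6) * (-1) = lam ^ 6 * (1 - (lam ^ 6)⁻¹) := by
      field_simp
      ring
    have hm' := congrArg τ hm
    rw [map_mul, map_mul, hl6, one_mul] at hm'
    rw [MulChar.pow_apply' _ (by norm_num), MulChar.pow_apply' _ (by norm_num), ← hm', mul_pow, hs,
      mul_comm]
  have hs : τ (-1) ^ 2 = 1 := by rw [← map_pow]; simp
  have m13 := termEq13 hord hψ _ hlx
  rw [hl] at m13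
  have p1 : τ ^ 1 = τ := pow_one τ
  have p0 : τ ^ 0 = 1 := pow_zero τ
  rw [show ∑ k, cc k * (gaussSum (τ ^ 3) ψ *
        ∑ χ : MulChar F ℂ, Ide τ ψ (lam ^ 6)⁻¹ (nn k) χ) =
      1 * (gaussSum (τ ^ 3) ψ * ∑ χ : MulChar F ℂ, Ide τ ψ (lam ^ 6)⁻¹ (nn 0) χ) +
      30 * (gaussSum (τ ^ 3) ψ * ∑ χ : MulChar F ℂ, Ide τ ψ (lam ^ 6)⁻¹ (nn 1) χ) +
      30 * (gaussSum (τ ^ 3) ψ * ∑ χ : MulChar F ℂ, Ide τ ψ (lam ^ 6)⁻¹ (nn 2) χ) +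
      15 * (gaussSum (τ ^ 3) ψ * ∑ χ : MulChar F ℂ, Ide τ ψ (lam ^ 6)⁻¹ (nn 3) χ) +
      20 * (gaussSum (τ ^ 3) ψ * ∑ χ : MulChar F ℂ, Ide τ ψ (lam ^ 6)⁻¹ (nn 4) χ) +
      60 * (gaussSum (τ ^ 3) ψ * ∑ χ : MulChar F ℂ, Ide τ ψ (lam ^ 6)⁻¹ (nn 5) χ) +
      60 * (gaussSum (τ ^ 3) ψ * ∑ χ : MulChar F ℂ, Ide τ ψ (lam ^ 6)⁻¹ (nn 6) χ) +
      90 * (gaussSum (τ ^ 3) ψ * ∑ χ : MulChar F ℂ, Ide τ ψ (lam ^ 6)⁻¹ (nn 7) χ) +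
      30 * (gaussSum (τ ^ 3) ψ * ∑ χ : MulChar F ℂ, Ide τ ψ (lam ^ 6)⁻¹ (nn 8) χ) +
      120 * (gaussSum (τ ^ 3) ψ * ∑ χ : MulChar F ℂ, Ide τ ψ (lam ^ 6)⁻¹ (nn 9) χ) +
      120 * (gaussSum (τ ^ 3) ψ * ∑ χ : MulChar F ℂ, Ide τ ψ (lam ^ 6)⁻¹ (nn 10) χ) +
      180 * (gaussSum (τ ^ 3) ψ * ∑ χ : MulChar F ℂ, Ide τ ψ (lam ^ 6)⁻¹ (nn 11) χ) +
      180 * (gaussSum (τ ^ 3) ψ * ∑ χ : MulChar F ℂ, Ide τ ψ (lam ^ 6)⁻¹ (nn 12) χ) +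
      360 * (gaussSum (τ ^ 3) ψ * ∑ χ : MulChar F ℂ, Ide τ ψ (lam ^ 6)⁻¹ (nn 13) χ) by
      simp only [Fin.sum_univ_succ, Fin.sum_univ_zero]
      simp only [cc]
      simp only [Matrix.cons_val_zero, Matrix.cons_val_succ, add_zero, add_assoc]
      rfl,
    termEq0 hord hψ ω hω,
    termEq1 hord hψ ω hω,
    termEq2 hord hψ ω hω,
    termEq3 hord hψ ω hω,
    termEq4 hord hψ ω hω,
    termEq5 hord hψ ω hω,
    termEq6 hord hψ ω hω,
    termEq7 hord hψ ω hω,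
    termEq8 hord hψ ω hω,
    termEq9 hord hψ _ hlx,
    termEq10 hord hψ _ hlx,
    termEq11 hord hψ _ hlx,
    termEq12 hord hψ _ hlx,
    m13] at M
  simp only [p1, p0] at M
  have hq0 : (Fintype.card F : ℂ) ≠ 0 := card_ne_zero'
  have hq1 : (Fintype.card F : ℂ) - 1 ≠ 0 := card_sub_one_ne_zero
  have hD : ((Fintype.card F : ℂ) ^ 5 - 1) / ((Fintype.card F : ℂ) - 1) *
      ((Fintype.card F : ℂ) - 1) = (Fintype.card F : ℂ) ^ 5 - 1 := div_mul_cancel₀ _ hq1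
  apply mul_left_cancel₀ (mul_ne_zero (pow_ne_zero 4 hq0) hq1)
  linear_combination M - (Fintype.card F : ℂ) ^ 4 * hD + 360 * (Fintype.card F : ℂ) ^ 6 *
    ((Fintype.card F : ℂ) - 1) * (τ ^ 3) (1 - lam ^ 6) * hs
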